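/- arXiv:1307.8436 — 11 statements merged into one kernel-verified Lean document; each statement's English description precedes it below -/
import Mathlib

section
/- Let R be a commutative ring and let A be the free associative unital R-algebra on generators a_0, a_1, a_2, … indexed by ℕ. Suppose φ : A → A is an R-algebra homomorphism such that for every k ∈ ℕ, φ(a_k) = u_k a_k + v_k, where u_k is a unit of R and v_k lies in the R-subalgebra generated by {a_j : j < k}. Then φ is bijective, and its inverse is an R-algebra homomorphism ψ satisfying, for every k ∈ ℕ, ψ(a_k) = u_k^{-1} a_k + w_k with w_k in the R-subalgebra generated by {a_j : j < k}. -/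
/-- Images of the generators under the inverse, by well-founded recursion. -/
noncomputable def invGen {R : Type*} [CommRing R] (u : ℕ → Rˣ) (v : ℕ → FreeAlgebra R ℕ)
    (k : ℕ) : FreeAlgebra R ℕ :=
  (((u k)⁻¹ : Rˣ) : R) • (FreeAlgebra.ι R k -
    FreeAlgebra.lift R (fun j => if _h : j < k then invGen u v j else 0) (v k))
termination_by k

theorem agree_adjoin {R : Type*} [CommRing R] (f g : FreeAlgebra R ℕ →ₐ[R] FreeAlgebra R ℕ)
    (k : ℕ) (h : ∀ j < k, f (FreeAlgebra.ι R j) = g (FreeAlgebra.ι R j))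
    (x : FreeAlgebra R ℕ)
    (hx : x ∈ Algebra.adjoin R (FreeAlgebra.ι R '' {j : ℕ | j < k})) : f x = g x := by
  have hle : Algebra.adjoin R (FreeAlgebra.ι R '' {j : ℕ | j < k}) ≤ AlgHom.equalizer f g := by
    rw [Algebra.adjoin_le_iff]
    rintro _ ⟨j, hj, rfl⟩
    exact h j hj
  exact hle hx

theorem lift_invGen {R : Type*} [CommRing R] (u : ℕ → Rˣ) (v : ℕ → FreeAlgebra R ℕ)
    (hv : ∀ k : ℕ, v k ∈ Algebra.adjoin R (FreeAlgebra.ι R '' {j : ℕ | j < k})) (k : ℕ) :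
    FreeAlgebra.lift R (invGen u v) (FreeAlgebra.ι R k) = (((u k)⁻¹ : Rˣ) : R) •
      (FreeAlgebra.ι R k - FreeAlgebra.lift R (invGen u v) (v k)) := by
  rw [FreeAlgebra.lift_ι_apply, invGen]
  congr 2
  refine agree_adjoin _ _ k (fun j hj => ?_) _ (hv k)
  simp [hj]

/-- **Elementary automorphisms of a semifree algebra are invertible, with elementary
inverse.**  Let `R` be a commutative ring and `A = FreeAlgebra R ℕ` the free associative
unital `R`-algebra on generators `a₀, a₁, a₂, …`.  If `φ : A → A` is an `R`-algebra
homomorphism with `φ (a k) = u k • a k + v k` where `u k` is a unit of `R` and `v k`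
lies in the `R`-subalgebra generated by `{a j : j < k}`, then `φ` is bijective and its
inverse is an `R`-algebra homomorphism `ψ` with `ψ (a k) = (u k)⁻¹ • a k + w k`,
`w k` in the subalgebra generated by `{a j : j < k}`. -/
theorem stmt_0 (R : Type*) [CommRing R]
    (φ : FreeAlgebra R ℕ →ₐ[R] FreeAlgebra R ℕ)
    (u : ℕ → Rˣ) (v : ℕ → FreeAlgebra R ℕ)
    (hv : ∀ k : ℕ, v k ∈ Algebra.adjoin R (FreeAlgebra.ι R '' {j : ℕ | j < k}))
    (hφ : ∀ k : ℕ, φ (FreeAlgebra.ι R k) = (u k : R) • FreeAlgebra.ι R k + v k) :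
    Function.Bijective φ ∧
      ∃ ψ : FreeAlgebra R ℕ →ₐ[R] FreeAlgebra R ℕ,
        (∀ x, ψ (φ x) = x) ∧ (∀ x, φ (ψ x) = x) ∧
        ∀ k : ℕ, ∃ w ∈ Algebra.adjoin R (FreeAlgebra.ι R '' {j : ℕ | j < k}),
          ψ (FreeAlgebra.ι R k) = (((u k)⁻¹ : Rˣ) : R) • FreeAlgebra.ι R k + w := by
  obtain ⟨ψ, hψ⟩ : ∃ ψ : FreeAlgebra R ℕ →ₐ[R] FreeAlgebra R ℕ, ∀ k,
      ψ (FreeAlgebra.ι R k) = (((u k)⁻¹ : Rˣ) : R) • (FreeAlgebra.ι R k - ψ (v k)) :=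
    ⟨_, lift_invGen u v hv⟩
  have h1 : ∀ x, ψ (φ x) = x := by
    have : ψ.comp φ = AlgHom.id R _ := by
      apply FreeAlgebra.hom_ext
      funext k
      simp [hφ, hψ, smul_smul]
    exact fun x => DFunLike.congr_fun this x
  have h2 : ∀ x, φ (ψ x) = x := by
    have : φ.comp ψ = AlgHom.id R _ := by
      apply FreeAlgebra.hom_ext
      funext k
      induction k using Nat.strong_induction_on with
      | _ k ih =>
        have e : φ (ψ (v k)) = v k :=
          agree_adjoin (φ.comp ψ) (AlgHom.id R _) k ih _ (hv k)
        simp [hφ, hψ, e, smul_smul]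
    exact fun x => DFunLike.congr_fun this x
  have h3 : ∀ k, ∀ x ∈ Algebra.adjoin R (FreeAlgebra.ι R '' {j : ℕ | j < k}),
      ψ x ∈ Algebra.adjoin R (FreeAlgebra.ι R '' {j : ℕ | j < k}) := by
    intro k
    induction k using Nat.strong_induction_on with
    | _ k ih =>
      intro x hx
      have hle : Algebra.adjoin R (FreeAlgebra.ι R '' {j : ℕ | j < k}) ≤
          (Algebra.adjoin R (FreeAlgebra.ι R '' {j : ℕ | j < k})).comap ψ := by
        rw [Algebra.adjoin_le_iff]
        rintro _ ⟨j, hj, rfl⟩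
        change ψ _ ∈ Algebra.adjoin R (FreeAlgebra.ι R '' {j : ℕ | j < k})
        rw [hψ]
        refine Subalgebra.smul_mem _ (sub_mem (Algebra.subset_adjoin (Set.mem_image_of_mem _ hj)) ?_) _
        refine Algebra.adjoin_mono (Set.image_mono ?_) (ih j hj _ (hv j))
        exact fun i (hi : i < j) => lt_trans hi hj
      exact hle hx
  refine ⟨⟨Function.LeftInverse.injective h1, Function.RightInverse.surjective h2⟩,
    ψ, h1, h2, fun k => ⟨-((((u k)⁻¹ : Rˣ) : R) • ψ (v k)), ?_, ?_⟩⟩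
  · exact neg_mem (Subalgebra.smul_mem _ (h3 k _ (hv k)) _)
  · rw [hψ, smul_sub, sub_eq_add_neg]
end

section
/- Let R be a commutative ring, I and J types, A the free associative unital R-algebra on generators x_i (i ∈ I), and S the free associative unital R-algebra on generators x_i (i ∈ I), e_j and f_j (j ∈ J); let ι : A → S be the canonical algebra embedding x_i ↦ x_i, and fix a degree function on generators, deg(x_i) = d_i ∈ ℤ, deg(f_j) = g_j ∈ ℤ, deg(e_j) = g_j + 1, with the degree of a word being the sum of the degrees of its letters. Suppose ∂_A : A → A and ∂ : S → S are R-linear maps with ∂_A ∘ ∂_A = 0, ∂ ∘ ∂ = 0, ∂ ∘ ι = ι ∘ ∂_A, ∂(e_j) = f_j and ∂(f_j) = 0 for all j ∈ J, ∂ maps the R-span of words of degree d into the R-span of words of degree d−1 for every d (and likewise for ∂_A), and ∂ satisfies the signed Leibniz rule: for every word v of degree d and every y ∈ S, ∂(v·y) = (∂v)·y + (−1)^d v·(∂y) (and likewise for ∂_A). Then ι maps ker ∂_A into ker ∂, and the induced map on homology is bijective: (i) for every z ∈ ker ∂ there exist z₀ ∈ ker ∂_A and y ∈ S with z = ι(z₀)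 + ∂(y); (ii) for every z₀ ∈ ker ∂_A with ι(z₀) in the image of ∂, there exists y₀ ∈ A with z₀ = ∂_A(y₀). In particular ker ∂_A / im ∂_A ≅ ker ∂ / im ∂ as R-modules. -/
/-- The product of the generators indexed by a list: a "word" in the free algebra. -/
noncomputable def FAword (R : Type*) [CommRing R] {X : Type*} (l : List X) :
    FreeAlgebra R X :=
  (l.map (FreeAlgebra.ι R)).prod

/-- The sign `(−1)^d` for an integer `d`, as an element of `R`. -/
noncomputable def sgnR (R : Type*) [CommRing R] (d : ℤ) : R :=
  (((-1 : Rˣ) ^ d : Rˣ) : R)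

theorem fa_span {R X : Type*} [CommRing R] (P : Submodule R (FreeAlgebra R X))
    (h1 : (1 : FreeAlgebra R X) ∈ P)
    (hm : ∀ x y, y ∈ P → FreeAlgebra.ι R x * y ∈ P) (y : FreeAlgebra R X) : y ∈ P := by
  have key : ∀ a : FreeAlgebra R X, ∀ y ∈ P, a * y ∈ P := by
    intro a
    induction a using FreeAlgebra.induction with
    | grade0 r =>
      intro y hy
      rw [← Algebra.smul_def]
      exact P.smul_mem r hy
    | grade1 x => exact hm x
    | mul a b ha hb =>
      intro y hy
      rw [mul_assoc]
      exact ha _ (hb _ hy)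
    | add a b ha hb =>
      intro y hy
      rw [add_mul]
      exact P.add_mem (ha _ hy) (hb _ hy)
  simpa using key y 1 h1

theorem fa_lin_ext {R X M : Type*} [CommRing R] [AddCommGroup M] [Module R M]
    (φ ψ : FreeAlgebra R X →ₗ[R] M) (h1 : φ 1 = ψ 1)
    (hm : ∀ x y, φ y = ψ y → φ (FreeAlgebra.ι R x * y) = ψ (FreeAlgebra.ι R x * y))
    (y : FreeAlgebra R X) : φ y = ψ y :=
  fa_span (LinearMap.eqLocus φ ψ) h1 hm y

theorem sgnR_add {R : Type*} [CommRing R] (a b : ℤ) : sgnR R (a + b) = sgnR R a * sgnR R b := by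
  simp [sgnR, zpow_add]

theorem sgnR_one {R : Type*} [CommRing R] : sgnR R 1 = -1 := by
  simp [sgnR]

theorem sgnR_sub_one {R : Type*} [CommRing R] (a : ℤ) : sgnR R (a - 1) = - sgnR R a := by
  have := sgnR_add (R := R) (a - 1) 1
  rw [sgnR_one, sub_add_cancel] at this
  rw [this]; ring

theorem sgnR_sq {R : Type*} [CommRing R] (a : ℤ) : sgnR R a * sgnR R a = 1 := by
  rw [sgnR, ← Units.val_mul, ← mul_zpow]
  simp

/-- The homotopy, for generators with signs `s i`. -/
theorem exists_htpy {R : Type*} [CommRing R] {I J : Type*} (s : I → R) :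
    ∃ h : FreeAlgebra R (I ⊕ (J ⊕ J)) →ₗ[R] FreeAlgebra R (I ⊕ (J ⊕ J)),
      h 1 = 0 ∧
      (∀ i y, h (FreeAlgebra.ι R (Sum.inl i) * y) =
        s i • (FreeAlgebra.ι R (Sum.inl i) * h y)) ∧
      (∀ j y, h (FreeAlgebra.ι R (Sum.inr (Sum.inl j)) * y) = 0) ∧
      (∀ j y, h (FreeAlgebra.ι R (Sum.inr (Sum.inr j)) * y) =
        FreeAlgebra.ι R (Sum.inr (Sum.inl j)) * y) := by
  let S := FreeAlgebra R (I ⊕ (J ⊕ J))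
  let L : S → (S →ₗ[R] S) := fun a => LinearMap.mulLeft R a
  let G : I ⊕ (J ⊕ J) → Module.End R (S × S) := fun x =>
    LinearMap.prod (L (FreeAlgebra.ι R x) ∘ₗ LinearMap.fst R S S)
      (match x with
        | Sum.inl i => s i • (L (FreeAlgebra.ι R (Sum.inl i)) ∘ₗ LinearMap.snd R S S)
        | Sum.inr (Sum.inl _) => 0
        | Sum.inr (Sum.inr j) =>
          L (FreeAlgebra.ι R (Sum.inr (Sum.inl j))) ∘ₗ LinearMap.fst R S S)
  let Φ := FreeAlgebra.lift R G
  have hfst : ∀ y : S, ∀ p : S × S, (Φ y p).1 = y * p.1 := by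
    intro y
    induction y using FreeAlgebra.induction with
    | grade0 r => intro p; simp [Φ, Algebra.smul_def, Module.algebraMap_end_apply]; rfl
    | grade1 x => intro p; simp [Φ, G, L]
    | mul a b ha hb => intro p; rw [map_mul, Module.End.mul_apply, ha, hb, mul_assoc]
    | add a b ha hb => intro p; rw [map_add, LinearMap.add_apply, Prod.fst_add, ha, hb, add_mul]
  let h : S →ₗ[R] S :=
    LinearMap.snd R S S ∘ₗ LinearMap.applyₗ ((1 : S), (0 : S)) ∘ₗ Φ.toLinearMap
  have hh : ∀ y, h y = (Φ y (1, 0)).2 := fun y => rfl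
  refine ⟨h, ?_, ?_, ?_, ?_⟩
  · rw [hh, map_one]; rfl
  · intro i y
    rw [hh, hh, map_mul, Module.End.mul_apply]
    simp [Φ, G, L]
  · intro i y
    rw [hh, map_mul, Module.End.mul_apply]
    simp [Φ, G, L]
  · intro i y
    have := hfst y (1, 0)
    rw [mul_one] at this
    rw [hh, map_mul, Module.End.mul_apply]
    refine Eq.trans ?_ (congrArg (fun t => FreeAlgebra.ι R (Sum.inr (Sum.inl i)) * t) this)
    simp [Φ, G, L]

/-- **A stabilization of a semifree DGA has the same homology.**
`A = FreeAlgebra R I` on generators `x i`, and `S = FreeAlgebra R (I ⊕ (J ⊕ J))`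
on generators `x i`, `e j = ι (inr (inl j))`, `f j = ι (inr (inr j))`;
`ι : A → S` is the canonical embedding.  Degrees: `deg (x i) = d i`,
`deg (f j) = g j`, `deg (e j) = g j + 1`; the degree of a word is the sum of the
degrees of its letters.  Given degree `−1` square-zero differentials `∂_A` on `A`
and `∂` on `S` satisfying the signed Leibniz rule, compatible with `ι`, and with
`∂ (e j) = f j`, `∂ (f j) = 0`, the map `ι` sends `ker ∂_A` into `ker ∂` and
induces a bijection on homology; in particular the homologies are isomorphic as
`R`-modules. -/
theorem stmt_1 (R : Type*) [CommRing R] (I J : Type*)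
    (d : I → ℤ) (g : J → ℤ)
    (ι : FreeAlgebra R I →ₐ[R] FreeAlgebra R (I ⊕ (J ⊕ J)))
    (hι : ∀ i : I, ι (FreeAlgebra.ι R i) = FreeAlgebra.ι R (Sum.inl i))
    (dA : FreeAlgebra R I →ₗ[R] FreeAlgebra R I)
    (dS : FreeAlgebra R (I ⊕ (J ⊕ J)) →ₗ[R] FreeAlgebra R (I ⊕ (J ⊕ J)))
    (hdA2 : ∀ x, dA (dA x) = 0)
    (hdS2 : ∀ x, dS (dS x) = 0)
    (hcomm : ∀ x, dS (ι x) = ι (dA x))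
    (he : ∀ j : J, dS (FreeAlgebra.ι R (Sum.inr (Sum.inl j))) =
        FreeAlgebra.ι R (Sum.inr (Sum.inr j)))
    (hf : ∀ j : J, dS (FreeAlgebra.ι R (Sum.inr (Sum.inr j))) = 0)
    (hdegA : ∀ k : ℤ, ∀ x ∈ Submodule.span R
        {x : FreeAlgebra R I | ∃ l : List I, (l.map d).sum = k ∧ x = FAword R l},
        dA x ∈ Submodule.span R
        {x : FreeAlgebra R I | ∃ l : List I, (l.map d).sum = k - 1 ∧ x = FAword R l})
    (hdegS : ∀ k : ℤ, ∀ x ∈ Submodule.span R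
        {x : FreeAlgebra R (I ⊕ (J ⊕ J)) | ∃ l : List (I ⊕ (J ⊕ J)),
          (l.map (Sum.elim d (Sum.elim (fun j => g j + 1) g))).sum = k ∧ x = FAword R l},
        dS x ∈ Submodule.span R
        {x : FreeAlgebra R (I ⊕ (J ⊕ J)) | ∃ l : List (I ⊕ (J ⊕ J)),
          (l.map (Sum.elim d (Sum.elim (fun j => g j + 1) g))).sum = k - 1 ∧ x = FAword R l})
    (hLeibA : ∀ (l : List I) (y : FreeAlgebra R I),
        dA (FAword R l * y) = dA (FAword R l) * y +
          sgnR R ((l.map d).sum) • (FAword R l * dA y))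
    (hLeibS : ∀ (l : List (I ⊕ (J ⊕ J))) (y : FreeAlgebra R (I ⊕ (J ⊕ J))),
        dS (FAword R l * y) = dS (FAword R l) * y +
          sgnR R ((l.map (Sum.elim d (Sum.elim (fun j => g j + 1) g))).sum) •
            (FAword R l * dS y)) :
    (∀ x, dA x = 0 → dS (ι x) = 0) ∧
    (∀ z, dS z = 0 → ∃ z₀, dA z₀ = 0 ∧ ∃ y, z = ι z₀ + dS y) ∧
    (∀ z₀, dA z₀ = 0 → (∃ y, ι z₀ = dS y) → ∃ y₀, z₀ = dA y₀) ∧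
    Nonempty
      ((LinearMap.ker dA ⧸
          Submodule.comap (LinearMap.ker dA).subtype (LinearMap.range dA)) ≃ₗ[R]
        (LinearMap.ker dS ⧸
          Submodule.comap (LinearMap.ker dS).subtype (LinearMap.range dS))) := by
  have LA : ∀ i y, dA (FreeAlgebra.ι R i * y) = dA (FreeAlgebra.ι R i) * y +
      sgnR R (d i) • (FreeAlgebra.ι R i * dA y) := by
    intro i y
    have := hLeibA [i] y
    simpa [FAword] using this
  have Lx : ∀ i y, dS (FreeAlgebra.ι R (Sum.inl i) * y) = ι (dA (FreeAlgebra.ι R i)) * y +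
      sgnR R (d i) • (FreeAlgebra.ι R (Sum.inl i) * dS y) := by
    intro i y
    have := hLeibS [Sum.inl i] y
    rw [← hcomm, hι]
    simpa [FAword] using this
  have Le : ∀ j y, dS (FreeAlgebra.ι R (Sum.inr (Sum.inl j)) * y) =
      FreeAlgebra.ι R (Sum.inr (Sum.inr j)) * y -
      sgnR R (g j) • (FreeAlgebra.ι R (Sum.inr (Sum.inl j)) * dS y) := by
    intro j y
    have := hLeibS [Sum.inr (Sum.inl j)] y
    rw [← he]
    simpa [FAword, sgnR_add, sgnR_one, sub_eq_add_neg] using this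
  have Lf : ∀ j y, dS (FreeAlgebra.ι R (Sum.inr (Sum.inr j)) * y) =
      sgnR R (g j) • (FreeAlgebra.ι R (Sum.inr (Sum.inr j)) * dS y) := by
    intro j y
    have := hLeibS [Sum.inr (Sum.inr j)] y
    simpa [FAword, hf] using this
  obtain ⟨h, h1, hx, hhe, hhf⟩ := exists_htpy (R := R) (I := I) (J := J) (fun i => sgnR R (d i))
  let π : FreeAlgebra R (I ⊕ (J ⊕ J)) →ₐ[R] FreeAlgebra R I :=
    FreeAlgebra.lift R (Sum.elim (FreeAlgebra.ι R) (fun _ => 0))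
  have πx : ∀ i, π (FreeAlgebra.ι R (Sum.inl i)) = FreeAlgebra.ι R i := by
    intro i; simp [π]
  have πr : ∀ j, π (FreeAlgebra.ι R (Sum.inr j)) = 0 := by
    intro i; simp [π]
  have πι : ∀ a, π (ι a) = a := by
    have : π.comp ι = AlgHom.id R _ := by
      apply FreeAlgebra.hom_ext
      funext i
      simp [hι, πx]
    exact fun a => DFunLike.congr_fun this a
  have hιa : ∀ a, h (ι a) = 0 := by
    intro a
    refine fa_lin_ext (h ∘ₗ ι.toLinearMap) 0 (by simp [h1]) ?_ a
    intro i y hy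
    have hy' : h (ι y) = 0 := hy
    simp [hι, hx, hy']
  have hword : ∀ (l : List I) y, h (ι (FAword R l) * y) =
      sgnR R ((l.map d).sum) • (ι (FAword R l) * h y) := by
    intro l y
    induction l with
    | nil => simp [FAword, sgnR]
    | cons i l ih =>
      have e : FAword R (i :: l) = FreeAlgebra.ι R i * FAword R l := by simp [FAword]
      rw [e, map_mul ι, hι, mul_assoc, hx, ih, List.map_cons, List.sum_cons, sgnR_add,
        mul_smul_comm, smul_smul, mul_assoc]
  have hspan : ∀ k : ℤ, ∀ a ∈ Submodule.span R
      {x : FreeAlgebra R I | ∃ l : List I, (l.map d).sum = k ∧ x = FAword R l},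
      ∀ y, h (ι a * y) = sgnR R k • (ι a * h y) := by
    intro k a ha y
    induction ha using Submodule.span_induction with
    | mem x hx' =>
      obtain ⟨l, rfl, rfl⟩ := hx'
      exact hword l y
    | zero => simp
    | add a b _ _ ha hb => rw [map_add, add_mul, map_add, ha, hb, add_mul, smul_add]
    | smul r a _ ha => rw [map_smul, smul_mul_assoc, map_smul, ha, smul_mul_assoc, smul_comm]
  have hdx : ∀ i y, h (ι (dA (FreeAlgebra.ι R i)) * y) =
      - (sgnR R (d i) • (ι (dA (FreeAlgebra.ι R i)) * h y)) := by
    intro i y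
    rw [← neg_smul, ← sgnR_sub_one]
    apply hspan
    apply hdegA
    apply Submodule.subset_span
    exact ⟨[i], by simp, by simp [FAword]⟩
  have πd : ∀ y, π (dS y) = dA (π y) := by
    refine fa_lin_ext (π.toLinearMap ∘ₗ dS) (dA ∘ₗ π.toLinearMap) ?_ ?_
    · have := hcomm 1
      rw [map_one] at this
      simp [this, πι]
    · intro x y hy
      have hy' : π (dS y) = dA (π y) := hy
      simp only [LinearMap.comp_apply, AlgHom.toLinearMap_apply]
      rcases x with i | j | j
      · rw [Lx, map_add, map_mul, map_smul, map_mul, map_mul, πι, πx, hy', LA]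
      · rw [Le, map_sub, map_mul, map_smul, map_mul, map_mul, πr, πr]; simp
      · rw [Lf, map_smul, map_mul, map_mul, πr]; simp
  have htpy : ∀ y, dS (h y) + h (dS y) = y - ι (π y) := by
    refine fa_lin_ext (dS ∘ₗ h + h ∘ₗ dS) (LinearMap.id - ι.toLinearMap ∘ₗ π.toLinearMap) ?_ ?_
    · have := hcomm 1
      rw [map_one] at this
      simp [this, hιa, h1]
    · intro x y hy
      have hy' : dS (h y) + h (dS y) = y - ι (π y) := hy
      simp only [LinearMap.comp_apply, AlgHom.toLinearMap_apply, LinearMap.add_apply,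
        LinearMap.sub_apply, LinearMap.id_apply]
      rcases x with i | j | j
      · rw [hx, Lx, map_smul, Lx, map_add, hdx, map_smul, hx, map_mul, πx, map_mul, hι,
          smul_add, smul_smul, smul_smul, sgnR_sq, one_smul, one_smul, ← mul_sub, ← hy', mul_add]
        abel
      · rw [hhe, Le, map_sub, map_smul, hhe, hhf, map_mul, πr]; simp
      · rw [hhf, Lf, Le, map_smul, hhf, map_mul, πr]; simp
  have c1 : ∀ x, dA x = 0 → dS (ι x) = 0 := by
    intro x hx'
    rw [hcomm, hx', map_zero]
  have c2 : ∀ z, dS z = 0 → ∃ z₀, dA z₀ = 0 ∧ ∃ y, z = ι z₀ + dS y := by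
    intro z hz
    refine ⟨π z, by rw [← πd, hz, map_zero], h z, ?_⟩
    have := htpy z
    rw [hz, map_zero, add_zero] at this
    rw [this]; abel
  have c3 : ∀ z₀, dA z₀ = 0 → (∃ y, ι z₀ = dS y) → ∃ y₀, z₀ = dA y₀ := by
    rintro z₀ _ ⟨y, hy⟩
    exact ⟨π y, by rw [← πd, ← hy, πι]⟩
  refine ⟨c1, c2, c3, ?_⟩
  let F : LinearMap.ker dA →ₗ[R] LinearMap.ker dS :=
    ι.toLinearMap.restrict (fun x hx' => c1 x hx')
  have hF : ∀ x, ((F x : LinearMap.ker dS) : FreeAlgebra R (I ⊕ (J ⊕ J))) = ι x := fun x => rfl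
  refine ⟨LinearEquiv.ofBijective (Submodule.mapQ _ _ F ?_) ⟨?_, ?_⟩⟩
  · rintro x ⟨y, hy⟩
    refine ⟨ι y, ?_⟩
    rw [hcomm, hy]; rfl
  · rw [injective_iff_map_eq_zero]
    intro q
    induction q using Submodule.Quotient.induction_on with
    | H x =>
      intro hq
      rw [Submodule.mapQ_apply, Submodule.Quotient.mk_eq_zero] at hq
      rw [Submodule.Quotient.mk_eq_zero]
      obtain ⟨y, hy⟩ := hq
      obtain ⟨y₀, hy₀⟩ := c3 x x.2 ⟨y, hy.symm⟩
      exact ⟨y₀, hy₀.symm⟩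
  · intro q
    induction q using Submodule.Quotient.induction_on with
    | H z =>
      obtain ⟨z₀, hz₀, y, hy⟩ := c2 z z.2
      refine ⟨Submodule.Quotient.mk ⟨z₀, hz₀⟩, ?_⟩
      rw [Submodule.mapQ_apply, Submodule.Quotient.eq]
      refine ⟨-y, ?_⟩
      change dS (-y) = ι z₀ - z
      rw [hy, map_neg]; abel
end

section
/- In the setting of a stabilization: let R be a commutative ring, A the free associative unital R-algebra on generators x_i (i ∈ I), S the free associative unital R-algebra on generators x_i (i ∈ I), e_j, f_j (j ∈ J), ι : A → S the embedding x_i ↦ x_i, π : S → A the algebra map with π(x_i) = x_i and π(e_j) = π(f_j) = 0, and a degree function on generators with deg(e_j) = deg(f_j) + 1, degrees of words given by summing letters. Suppose ∂ : S → S is R-linear, sends the span of words of degree d into the span of words of degree d−1, satisfies the signed Leibniz rule ∂(v·y) = (∂v)·y + (−1)^{deg v} v·(∂y) for every word v and y ∈ S, satisfies ∂(ι(A)) ⊆ ι(A), ∂(e_j) = f_j, ∂(f_j) = 0. Every word in S is uniquely of the form: a word v in the letters x_i only; or v·e_j·w; or v·f_j·w, where v is a word in the x_i only and w is an arbitrary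 word. Define the R-linear map H : S → S on words by H(v) = 0, H(v e_j w) = 0, and H(v f_j w) = (−1)^{deg(v)+1} v e_j w. Then H ∘ ∂ + ∂ ∘ H = ι ∘ π − id_S. -/
theorem FAword_append (R : Type*) [CommRing R] {X : Type*} (l m : List X) :
    FAword R (l ++ m) = FAword R l * FAword R m := by
  simp [FAword]

theorem FAword_cons (R : Type*) [CommRing R] {X : Type*} (a : X) (m : List X) :
    FAword R (a :: m) = FreeAlgebra.ι R a * FAword R m := by
  simp [FAword]

theorem FAword_single (R : Type*) [CommRing R] {X : Type*} (a : X) :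
    FAword R [a] = FreeAlgebra.ι R a := by
  simp [FAword]

theorem FAword_span (R : Type*) [CommRing R] (X : Type*) (x : FreeAlgebra R X) :
    x ∈ Submodule.span R (Set.range (FAword R (X := X))) := by
  induction x using FreeAlgebra.induction with
  | grade0 r =>
    rw [Algebra.algebraMap_eq_smul_one]
    exact Submodule.smul_mem _ _ (Submodule.subset_span ⟨[], by simp [FAword]⟩)
  | grade1 a => exact Submodule.subset_span ⟨[a], FAword_single R a⟩
  | mul a b ha hb =>
    have h := Submodule.mul_mem_mul ha hb
    rw [Submodule.span_mul_span] at h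
    refine Submodule.span_mono ?_ h
    rintro _ ⟨_, ⟨l, rfl⟩, _, ⟨m, rfl⟩, rfl⟩
    exact ⟨l ++ m, FAword_append R l m⟩
  | add a b ha hb => exact Submodule.add_mem _ ha hb

theorem FAword_ind {R : Type*} [CommRing R] {X : Type*} {M : Type*} [AddCommGroup M] [Module R M]
    (f h : FreeAlgebra R X →ₗ[R] M) (hw : ∀ l, f (FAword R l) = h (FAword R l)) (x) :
    f x = h x := by
  have : f = h := by
    apply LinearMap.ext_on (s := Set.range (FAword R (X := X)))
    · exact eq_top_iff.2 fun x _ => FAword_span R X x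
    · rintro _ ⟨l, rfl⟩; exact hw l
  rw [this]

theorem sgnR_succ (R : Type*) [CommRing R] (a : ℤ) : sgnR R (a + 1) = - sgnR R a := by
  simp [sgnR, zpow_add]

theorem sgnR_mul_self (R : Type*) [CommRing R] (a : ℤ) : sgnR R a * sgnR R a = 1 := by
  unfold sgnR
  rw [← Units.val_mul, ← mul_zpow]
  simp

theorem word_cases {I J : Type*} (l : List (I ⊕ (J ⊕ J))) :
    (∃ v : List I, l = v.map Sum.inl) ∨
    (∃ (v : List I) (j : J) (w : _), l = v.map Sum.inl ++ Sum.inr (Sum.inl j) :: w) ∨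
    (∃ (v : List I) (j : J) (w : _), l = v.map Sum.inl ++ Sum.inr (Sum.inr j) :: w) := by
  induction l with
  | nil => exact Or.inl ⟨[], rfl⟩
  | cons a l ih =>
    rcases a with i | j | j
    · rcases ih with ⟨v, rfl⟩ | ⟨v, j, w, rfl⟩ | ⟨v, j, w, rfl⟩
      · exact Or.inl ⟨i :: v, rfl⟩
      · exact Or.inr (Or.inl ⟨i :: v, j, w, rfl⟩)
      · exact Or.inr (Or.inr ⟨i :: v, j, w, rfl⟩)
    · exact Or.inr (Or.inl ⟨[], j, l, rfl⟩)
    · exact Or.inr (Or.inr ⟨[], j, l, rfl⟩)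

/-- **The chain homotopy identity for a stabilization.**
`A = FreeAlgebra R I` on generators `x i`, `S = FreeAlgebra R (I ⊕ (J ⊕ J))` on
generators `x i`, `e j = ι (inr (inl j))`, `f j = ι (inr (inr j))`; `ι : A → S` is
the embedding `x i ↦ x i` and `π : S → A` the algebra map with `π (x i) = x i`,
`π (e j) = π (f j) = 0`.  Degrees: `deg (x i) = d i`, `deg (f j) = g j`,
`deg (e j) = g j + 1`; the degree of a word is the sum of the degrees of its
letters.  Suppose `∂ : S → S` is `R`-linear of degree `−1`, satisfies the signed
Leibniz rule, preserves `ι(A)`, and `∂ (e j) = f j`, `∂ (f j) = 0`.  Let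
`H : S → S` be the `R`-linear map with `H v = 0` and `H (v * e j * w) = 0` for
every word `v` in the letters `x` and every word `w`, and
`H (v * f j * w) = (−1)^(deg v + 1) • (v * e j * w)`.
Then `H ∘ ∂ + ∂ ∘ H = ι ∘ π − id`. -/
theorem stmt_2 (R : Type*) [CommRing R] (I J : Type*)
    (d : I → ℤ) (g : J → ℤ)
    (ι : FreeAlgebra R I →ₐ[R] FreeAlgebra R (I ⊕ (J ⊕ J)))
    (hι : ∀ i : I, ι (FreeAlgebra.ι R i) = FreeAlgebra.ι R (Sum.inl i))
    (π : FreeAlgebra R (I ⊕ (J ⊕ J)) →ₐ[R] FreeAlgebra R I)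
    (hπx : ∀ i : I, π (FreeAlgebra.ι R (Sum.inl i)) = FreeAlgebra.ι R i)
    (hπe : ∀ j : J, π (FreeAlgebra.ι R (Sum.inr (Sum.inl j))) = 0)
    (hπf : ∀ j : J, π (FreeAlgebra.ι R (Sum.inr (Sum.inr j))) = 0)
    (dS : FreeAlgebra R (I ⊕ (J ⊕ J)) →ₗ[R] FreeAlgebra R (I ⊕ (J ⊕ J)))
    (hrange : ∀ x : FreeAlgebra R I, ∃ x' : FreeAlgebra R I, dS (ι x) = ι x')
    (he : ∀ j : J, dS (FreeAlgebra.ι R (Sum.inr (Sum.inl j))) =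
        FreeAlgebra.ι R (Sum.inr (Sum.inr j)))
    (hf : ∀ j : J, dS (FreeAlgebra.ι R (Sum.inr (Sum.inr j))) = 0)
    (hdegS : ∀ k : ℤ, ∀ x ∈ Submodule.span R
        {x : FreeAlgebra R (I ⊕ (J ⊕ J)) | ∃ l : List (I ⊕ (J ⊕ J)),
          (l.map (Sum.elim d (Sum.elim (fun j => g j + 1) g))).sum = k ∧ x = FAword R l},
        dS x ∈ Submodule.span R
        {x : FreeAlgebra R (I ⊕ (J ⊕ J)) | ∃ l : List (I ⊕ (J ⊕ J)),
          (l.map (Sum.elim d (Sum.elim (fun j => g j + 1) g))).sum = k - 1 ∧ x = FAword R l})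
    (hLeibS : ∀ (l : List (I ⊕ (J ⊕ J))) (y : FreeAlgebra R (I ⊕ (J ⊕ J))),
        dS (FAword R l * y) = dS (FAword R l) * y +
          sgnR R ((l.map (Sum.elim d (Sum.elim (fun j => g j + 1) g))).sum) •
            (FAword R l * dS y))
    (H : FreeAlgebra R (I ⊕ (J ⊕ J)) →ₗ[R] FreeAlgebra R (I ⊕ (J ⊕ J)))
    (hH1 : ∀ l : List I, H (FAword R (l.map Sum.inl)) = 0)
    (hH2 : ∀ (l : List I) (j : J) (w : List (I ⊕ (J ⊕ J))),
        H (FAword R (l.map Sum.inl) * FreeAlgebra.ι R (Sum.inr (Sum.inl j)) * FAword R w)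
          = 0)
    (hH3 : ∀ (l : List I) (j : J) (w : List (I ⊕ (J ⊕ J))),
        H (FAword R (l.map Sum.inl) * FreeAlgebra.ι R (Sum.inr (Sum.inr j)) * FAword R w)
          = sgnR R ((l.map d).sum + 1) •
              (FAword R (l.map Sum.inl) * FreeAlgebra.ι R (Sum.inr (Sum.inl j)) *
                FAword R w)) :
    ∀ x, H (dS x) + dS (H x) = ι (π x) - x := by
  have hιw : ∀ v : List I, ι (FAword R v) = FAword R (v.map Sum.inl) := by
    intro v
    induction v with
    | nil => simp [FAword]
    | cons a v ih => rw [List.map_cons, FAword_cons, FAword_cons, map_mul, hι, ih]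
  have hπw : ∀ v : List I, π (FAword R (v.map Sum.inl)) = FAword R v := by
    intro v
    induction v with
    | nil => simp [FAword]
    | cons a v ih => rw [List.map_cons, FAword_cons, FAword_cons, map_mul, hπx, ih]
  have hπι : ∀ a, π (ι a) = a := fun a =>
    FAword_ind (π.toLinearMap ∘ₗ ι.toLinearMap) LinearMap.id
      (fun l => by simp [hιw, hπw]) a
  have hdeg : ∀ v : List I, ((v.map Sum.inl).map
      (Sum.elim d (Sum.elim (fun j => g j + 1) g))).sum = (v.map d).sum := by
    intro v; simp [Function.comp_def]
  -- the differential of an x-word is a combination of x-words of the right degree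
  have hdv : ∀ v : List I, dS (FAword R (v.map Sum.inl)) ∈ Submodule.span R
      {x : FreeAlgebra R (I ⊕ (J ⊕ J)) | ∃ u : List I,
        (u.map d).sum = (v.map d).sum - 1 ∧ x = FAword R (u.map Sum.inl)} := by
    intro v
    have h1 := hdegS (v.map d).sum (FAword R (v.map Sum.inl))
      (Submodule.subset_span ⟨_, hdeg v, rfl⟩)
    obtain ⟨a, ha⟩ := hrange (FAword R v)
    rw [hιw] at ha
    have h2 : dS (FAword R (v.map Sum.inl)) =
        (ι.toLinearMap ∘ₗ π.toLinearMap) (dS (FAword R (v.map Sum.inl))) := by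
      simp [ha, hπι]
    rw [h2]
    generalize dS (FAword R (v.map Sum.inl)) = y at h1
    induction h1 using Submodule.span_induction with
    | zero => simp
    | add x y _ _ hx hy => rw [map_add]; exact Submodule.add_mem _ hx hy
    | smul r x _ hx => rw [map_smul]; exact Submodule.smul_mem _ _ hx
    | mem x hx =>
      obtain ⟨l, hl, rfl⟩ := hx
      rcases word_cases l with ⟨u, rfl⟩ | ⟨u, j, w, rfl⟩ | ⟨u, j, w, rfl⟩
      · refine Submodule.subset_span ⟨u, by rw [← hdeg u, hl], ?_⟩
        simp [hπw, hιw]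
      · simp [FAword_append, FAword_cons, hπe]
      · simp [FAword_append, FAword_cons, hπf]
  have hHe : ∀ (u : List I) (j : J) (y), H (FAword R (u.map Sum.inl) *
      FreeAlgebra.ι R (Sum.inr (Sum.inl j)) * y) = 0 := fun u j y =>
    FAword_ind (H ∘ₗ LinearMap.mulLeft R (FAword R (u.map Sum.inl) *
      FreeAlgebra.ι R (Sum.inr (Sum.inl j)))) 0 (fun l => hH2 u j l) y
  have hHf : ∀ (u : List I) (j : J) (y), H (FAword R (u.map Sum.inl) *
      FreeAlgebra.ι R (Sum.inr (Sum.inr j)) * y) = sgnR R ((u.map d).sum + 1) •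
        (FAword R (u.map Sum.inl) * FreeAlgebra.ι R (Sum.inr (Sum.inl j)) * y) := by
    intro u j y
    have h := FAword_ind (H ∘ₗ LinearMap.mulLeft R (FAword R (u.map Sum.inl) *
      FreeAlgebra.ι R (Sum.inr (Sum.inr j))))
      (sgnR R ((u.map d).sum + 1) • LinearMap.mulLeft R (FAword R (u.map Sum.inl) *
      FreeAlgebra.ι R (Sum.inr (Sum.inl j)))) (fun l => by
        simp only [LinearMap.comp_apply, LinearMap.smul_apply, LinearMap.mulLeft_apply, hH3]) y
    simpa only [LinearMap.comp_apply, LinearMap.smul_apply, LinearMap.mulLeft_apply] using h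
  have hHd : ∀ v : List I, H (dS (FAword R (v.map Sum.inl))) = 0 := by
    intro v
    have hv := hdv v
    generalize dS (FAword R (v.map Sum.inl)) = z at hv ⊢
    induction hv using Submodule.span_induction with
    | zero => simp
    | add x y _ _ hx hy => rw [map_add, hx, hy, add_zero]
    | smul r x _ hx => rw [map_smul, hx, smul_zero]
    | mem x hx => obtain ⟨u, _, rfl⟩ := hx; exact hH1 u
  have hHde : ∀ (v : List I) (j : J) (y), H (dS (FAword R (v.map Sum.inl)) *
      FreeAlgebra.ι R (Sum.inr (Sum.inl j)) * y) = 0 := by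
    intro v j y
    have hv := hdv v
    generalize dS (FAword R (v.map Sum.inl)) = z at hv ⊢
    induction hv using Submodule.span_induction with
    | zero => simp
    | add x y _ _ hx hy => rw [add_mul, add_mul, map_add, hx, hy, add_zero]
    | smul r x _ hx => rw [smul_mul_assoc, smul_mul_assoc, map_smul, hx, smul_zero]
    | mem x hx => obtain ⟨u, _, rfl⟩ := hx; exact hHe u j y
  have hHdf : ∀ (v : List I) (j : J) (y), H (dS (FAword R (v.map Sum.inl)) *
      FreeAlgebra.ι R (Sum.inr (Sum.inr j)) * y) = sgnR R ((v.map d).sum) •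
      (dS (FAword R (v.map Sum.inl)) * FreeAlgebra.ι R (Sum.inr (Sum.inl j)) * y) := by
    intro v j y
    have hv := hdv v
    generalize dS (FAword R (v.map Sum.inl)) = z at hv ⊢
    induction hv using Submodule.span_induction with
    | zero => simp
    | add x y _ _ hx hy => simp only [add_mul, map_add, hx, hy, smul_add]
    | smul r x _ hx =>
      rw [smul_mul_assoc, smul_mul_assoc, map_smul, hx, smul_mul_assoc, smul_mul_assoc, smul_comm]
    | mem x hx =>
      obtain ⟨u, hu, rfl⟩ := hx
      rw [hHf u j y, hu, sub_add_cancel]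
  have hdE : ∀ (v : List I) (j : J) (y), dS (FAword R (v.map Sum.inl) *
      FreeAlgebra.ι R (Sum.inr (Sum.inl j)) * y) =
      dS (FAword R (v.map Sum.inl)) * FreeAlgebra.ι R (Sum.inr (Sum.inl j)) * y +
      sgnR R (v.map d).sum • (FAword R (v.map Sum.inl) *
        FreeAlgebra.ι R (Sum.inr (Sum.inr j)) * y) -
      sgnR R (v.map d).sum • sgnR R (g j) • (FAword R (v.map Sum.inl) *
        FreeAlgebra.ι R (Sum.inr (Sum.inl j)) * dS y) := by
    intro v j y
    have h := hLeibS [Sum.inr (Sum.inl j)] y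
    rw [FAword_single, he] at h
    simp only [List.map_cons, List.map_nil, List.sum_cons, List.sum_nil, add_zero,
      Sum.elim_inr, Sum.elim_inl, sgnR_succ] at h
    rw [mul_assoc, hLeibS, hdeg, h]
    simp only [mul_add, smul_add, mul_smul_comm, mul_assoc, neg_smul, smul_neg, mul_neg]
    abel
  have hdF : ∀ (v : List I) (j : J) (y), dS (FAword R (v.map Sum.inl) *
      FreeAlgebra.ι R (Sum.inr (Sum.inr j)) * y) =
      dS (FAword R (v.map Sum.inl)) * FreeAlgebra.ι R (Sum.inr (Sum.inr j)) * y +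
      sgnR R (v.map d).sum • sgnR R (g j) • (FAword R (v.map Sum.inl) *
        FreeAlgebra.ι R (Sum.inr (Sum.inr j)) * dS y) := by
    intro v j y
    have h := hLeibS [Sum.inr (Sum.inr j)] y
    rw [FAword_single, hf] at h
    simp only [List.map_cons, List.map_nil, List.sum_cons, List.sum_nil, add_zero,
      Sum.elim_inr, zero_mul, zero_add] at h
    rw [mul_assoc, hLeibS, hdeg, h]
    simp only [mul_smul_comm, mul_assoc]
  intro x
  refine FAword_ind (H ∘ₗ dS + dS ∘ₗ H) (ι.toLinearMap ∘ₗ π.toLinearMap - LinearMap.id) ?_ x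
  intro l
  simp only [LinearMap.add_apply, LinearMap.sub_apply, LinearMap.comp_apply, LinearMap.id_apply,
    AlgHom.toLinearMap_apply]
  rcases word_cases l with ⟨v, rfl⟩ | ⟨v, j, w, rfl⟩ | ⟨v, j, w, rfl⟩
  · rw [hHd, hH1, hπw, hιw]; simp
  · have hs := sgnR_mul_self R (v.map d).sum
    rw [FAword_append, FAword_cons, map_mul π, map_mul π, hπe, ← mul_assoc, hHe, hdE]
    simp only [map_add, map_sub, map_smul, hHde, hHe, hHf, sgnR_succ]
    simp [smul_smul, hs]
  · have hs := sgnR_mul_self R (v.map d).sum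
    rw [FAword_append, FAword_cons, map_mul π, map_mul π, hπf, ← mul_assoc, hHf, hdF]
    simp only [map_add, map_smul, hHdf, hHf, sgnR_succ, hdE]
    simp only [neg_smul, smul_neg, smul_add, smul_sub, smul_smul, ← mul_assoc, neg_mul, mul_neg, hs, one_smul,
      zero_mul, mul_zero, map_zero]
    simp only [mul_right_comm _ (sgnR R (g j)) _, hs, one_mul, one_smul]
    abel
end

section
/- Fix n ≥ 1 and a function m : {1,…,n} → ℤ; set σ_i = (−1)^{m(i)}. Let 𝒜_n be the free associative unital ℤ-algebra on generators c_{ij}^p for p ≥ 1 and 1 ≤ i,j ≤ n, and for p = 0 and 1 ≤ i < j ≤ n, and adopt the convention that c_{ij}^0 denotes 0 ∈ 𝒜_n whenever i ≥ j. Define elements D(c_{ij}^p) = δ_{ij}·δ_{p,1}·1 + Σ_{ℓ=0}^{p} Σ_{k=1}^{n} σ_i σ_k · c_{ik}^ℓ · c_{kj}^{p−ℓ} ∈ 𝒜_n (δ denoting Kronecker delta). Then for all 1 ≤ i,j ≤ n and all p ≥ 0, Σ_{ℓ=0}^{p} Σ_{k=1}^{n} σ_i σ_k · [ D(c_{ik}^ℓ)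 · c_{kj}^{p−ℓ} + (−1)^{2ℓ−1+m(i)−m(k)} · c_{ik}^ℓ · D(c_{kj}^{p−ℓ}) ] = 0 in 𝒜_n. Consequently, the internal differential ∂_n, defined on generators by ∂_n(c_{ij}^p) = D(c_{ij}^p) and extended by the signed Leibniz rule with respect to the grading |c_{ij}^p| = 2p − 1 + m(i) − m(j), satisfies ∂_n ∘ ∂_n = 0. -/
/-- The sign `(−1)^d` for an integer `d`. -/
noncomputable def sgnZ (d : ℤ) : ℤ := (((-1 : ℤˣ) ^ d : ℤˣ) : ℤ)

/-- Index type for the generators `c_{ij}^p` of the internal DGA on `n` strands: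
`p ≥ 1` and `1 ≤ i, j ≤ n`, or `p = 0` and `i < j`. -/
abbrev IntGen (n : ℕ) := {t : Fin n × Fin n × ℕ // 1 ≤ t.2.2 ∨ t.1 < t.2.1}

/-- The generator `c_{ij}^p` of the internal DGA, with the convention that
`c_{ij}^0 = 0` for `i ≥ j`. -/
noncomputable def cGen (n : ℕ) (i j : Fin n) (p : ℕ) : FreeAlgebra ℤ (IntGen n) :=
  if h : 1 ≤ p ∨ i < j then FreeAlgebra.ι ℤ (⟨(i, j, p), h⟩ : IntGen n) else 0

/-- The value of the internal differential on the generator `c_{ij}^p`: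
`D(c_{ij}^p) = δ_{ij} δ_{p,1} · 1 + Σ_{ℓ=0}^{p} Σ_{k=1}^{n} σ_i σ_k c_{ik}^ℓ c_{kj}^{p−ℓ}`,
where `σ_i = (−1)^{m i}`. -/
noncomputable def Dint (n : ℕ) (m : Fin n → ℤ) (i j : Fin n) (p : ℕ) :
    FreeAlgebra ℤ (IntGen n) :=
  (if i = j ∧ p = 1 then 1 else 0) +
    ∑ ℓ ∈ Finset.range (p + 1), ∑ k : Fin n,
      (sgnZ (m i) * sgnZ (m k)) • (cGen n i k ℓ * cGen n k j (p - ℓ))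

theorem sgnZ_add (a b : ℤ) : sgnZ (a + b) = sgnZ a * sgnZ b := by
  simp [sgnZ, zpow_add]

theorem sgnZ_mul_self (a : ℤ) : sgnZ a * sgnZ a = 1 := by
  rw [sgnZ, ← Units.val_mul, Int.units_mul_self, Units.val_one]

theorem sgnZ_neg (a : ℤ) : sgnZ (-a) = sgnZ a := by
  simp [sgnZ]

theorem sgnZ_deg (a b : ℤ) (p : ℕ) : sgnZ (2 * (p : ℤ) - 1 + a - b) = -(sgnZ a * sgnZ b) := by
  have h : 2 * (p : ℤ) - 1 + a - b = ((p : ℤ) + p) + ((-1) + (a + (-b))) := by ring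
  have h1 : sgnZ (-1) = -1 := by simp [sgnZ]
  rw [h, sgnZ_add, sgnZ_add, sgnZ_add, sgnZ_add, sgnZ_mul_self, h1, sgnZ_neg]
  ring

theorem cGen_zero (n : ℕ) (i j : Fin n) (h : ¬ i < j) : cGen n i j 0 = 0 := by
  simp [cGen, h]

theorem Dint_zero (n : ℕ) (m : Fin n → ℤ) (i j : Fin n) (h : ¬ i < j) : Dint n m i j 0 = 0 := by
  unfold Dint
  simp only [zero_add, Finset.range_one, Finset.sum_singleton]
  rw [if_neg (by simp), zero_add]
  refine Finset.sum_eq_zero fun k _ => ?_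
  by_cases hk : i < k
  · rw [cGen_zero n k j (fun h' => h (hk.trans h'))]; simp
  · rw [cGen_zero n i k hk]; simp

/-- reassociation of triple convolution sums -/
theorem triple_sum {A : Type*} [AddCommMonoid A] (F : ℕ → ℕ → ℕ → A) (p : ℕ) :
    ∑ l ∈ Finset.range (p + 1), ∑ a ∈ Finset.range (l + 1), F a (l - a) (p - l) =
    ∑ a ∈ Finset.range (p + 1), ∑ b ∈ Finset.range (p - a + 1), F a b (p - a - b) := by
  have := Finset.sum_range_diag_flip (p + 1) (fun a b => F a b (p - a - b))
  calc _ = ∑ l ∈ Finset.range (p + 1), ∑ a ∈ Finset.range (l + 1), F a (l - a) (p - a - (l - a)) := by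
        refine Finset.sum_congr rfl fun l hl => Finset.sum_congr rfl fun a ha => ?_
        rw [Finset.mem_range] at hl ha
        congr 1; omega
    _ = _ := this
    _ = _ := by
        refine Finset.sum_congr rfl fun a ha => ?_
        rw [Finset.mem_range] at ha
        rw [show p + 1 - a = p - a + 1 by omega]

theorem part_left (n : ℕ) (m : Fin n → ℤ) (i j : Fin n) (p : ℕ) :
    ∑ l ∈ Finset.range (p + 1), ∑ k : Fin n,
      (sgnZ (m i) * sgnZ (m k)) • (Dint n m i k l * cGen n k j (p - l)) =
    (if 1 ≤ p then cGen n i j (p - 1) else 0) +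
      ∑ a ∈ Finset.range (p + 1), ∑ b ∈ Finset.range (p - a + 1), ∑ k : Fin n, ∑ k' : Fin n,
        (sgnZ (m k) * sgnZ (m k')) • (cGen n i k a * cGen n k k' b * cGen n k' j (p - a - b)) := by
  rw [← triple_sum (fun a b c => ∑ k : Fin n, ∑ k' : Fin n,
        (sgnZ (m k) * sgnZ (m k')) • (cGen n i k a * cGen n k k' b * cGen n k' j c))]
  simp only [Dint, add_mul, smul_add, Finset.sum_add_distrib]
  congr 1
  · have h : ∀ l ∈ Finset.range (p + 1), ∑ k : Fin n, (sgnZ (m i) * sgnZ (m k)) •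
        ((if i = k ∧ l = 1 then (1 : FreeAlgebra ℤ (IntGen n)) else 0) * cGen n k j (p - l)) =
        if l = 1 then cGen n i j (p - 1) else 0 := by
      intro l _
      rw [Finset.sum_eq_single i]
      · by_cases hl : l = 1
        · simp [hl, sgnZ_mul_self]
        · simp [hl]
      · intro k _ hk
        simp [Ne.symm hk]
      · simp
    rw [Finset.sum_congr rfl h, Finset.sum_ite_eq']
    simp only [Finset.mem_range]
    congr 1
    simp [Nat.succ_le_iff]
  · refine Finset.sum_congr rfl fun l _ => ?_
    simp only [Finset.sum_mul, Finset.smul_sum]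
    rw [Finset.sum_comm]
    refine Finset.sum_congr rfl fun a _ => ?_
    rw [Finset.sum_comm]
    refine Finset.sum_congr rfl fun k _ => Finset.sum_congr rfl fun k' _ => ?_
    rw [smul_mul_assoc, smul_smul]
    congr 1
    linear_combination (sgnZ (m k) * sgnZ (m k')) * sgnZ_mul_self (m i)

theorem part_right (n : ℕ) (m : Fin n → ℤ) (i j : Fin n) (p : ℕ) :
    ∑ l ∈ Finset.range (p + 1), ∑ k : Fin n,
      (cGen n i k l * Dint n m k j (p - l)) =
    (if 1 ≤ p then cGen n i j (p - 1) else 0) +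
      ∑ a ∈ Finset.range (p + 1), ∑ b ∈ Finset.range (p - a + 1), ∑ k : Fin n, ∑ k' : Fin n,
        (sgnZ (m k) * sgnZ (m k')) • (cGen n i k a * cGen n k k' b * cGen n k' j (p - a - b)) := by
  simp only [Dint, mul_add, Finset.sum_add_distrib]
  congr 1
  · have h : ∀ l ∈ Finset.range (p + 1), ∑ k : Fin n,
        (cGen n i k l * (if k = j ∧ p - l = 1 then (1 : FreeAlgebra ℤ (IntGen n)) else 0)) =
        if p - l = 1 then cGen n i j l else 0 := by
      intro l _
      rw [Finset.sum_eq_single j]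
      · by_cases hl : p - l = 1 <;> simp [hl]
      · intro k _ hk
        simp [hk]
      · simp
    rw [Finset.sum_congr rfl h]
    by_cases hp : 1 ≤ p
    · rw [if_pos hp, Finset.sum_eq_single (p - 1)]
      · rw [if_pos (by omega)]
      · intro b _ hb
        rw [if_neg (by omega)]
      · intro hb
        exact absurd (Finset.mem_range.2 (by omega)) hb
    · rw [if_neg hp]
      refine Finset.sum_eq_zero fun l _ => ?_
      rw [if_neg (by omega)]
  · refine Finset.sum_congr rfl fun l _ => ?_
    simp only [Finset.mul_sum]
    rw [Finset.sum_comm]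
    refine Finset.sum_congr rfl fun a _ => ?_
    refine Finset.sum_congr rfl fun k _ => Finset.sum_congr rfl fun k' _ => ?_
    rw [mul_smul_comm, mul_assoc]

theorem part_one (n : ℕ) (m : Fin n → ℤ) (i j : Fin n) (p : ℕ) :
      ∑ ℓ ∈ Finset.range (p + 1), ∑ k : Fin n,
        (sgnZ (m i) * sgnZ (m k)) •
          (Dint n m i k ℓ * cGen n k j (p - ℓ) +
            sgnZ (2 * (ℓ : ℤ) - 1 + m i - m k) • (cGen n i k ℓ * Dint n m k j (p - ℓ)))
        = 0 := by
  have h : ∀ (l : ℕ) (k : Fin n), (sgnZ (m i) * sgnZ (m k)) •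
          (Dint n m i k l * cGen n k j (p - l) +
            sgnZ (2 * (l : ℤ) - 1 + m i - m k) • (cGen n i k l * Dint n m k j (p - l))) =
        (sgnZ (m i) * sgnZ (m k)) • (Dint n m i k l * cGen n k j (p - l)) -
          cGen n i k l * Dint n m k j (p - l) := by
    intro l k
    rw [smul_add, smul_smul, sgnZ_deg, sub_eq_add_neg]
    congr 1
    rw [show sgnZ (m i) * sgnZ (m k) * -(sgnZ (m i) * sgnZ (m k)) = -1 by
      linear_combination (-(sgnZ (m k) * sgnZ (m k))) * sgnZ_mul_self (m i) - sgnZ_mul_self (m k)]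
    simp
  simp only [h, Finset.sum_sub_distrib]
  rw [part_left, part_right, sub_self]

/-- `x` satisfies the Leibniz rule with sign `s` -/
def Lz {A : Type*} [Ring A] (dl : A →ₗ[ℤ] A) (s : ℤ) (x : A) : Prop :=
  ∀ y, dl (x * y) = dl x * y + s • (x * dl y)

theorem Lz_sum {A : Type*} [Ring A] (dl : A →ₗ[ℤ] A) (s : ℤ) {ι : Type*} (S : Finset ι)
    (f : ι → A) (h : ∀ a ∈ S, Lz dl s (f a)) : Lz dl s (∑ a ∈ S, f a) := by
  intro y
  rw [Finset.sum_mul, map_sum, map_sum, Finset.sum_mul, Finset.sum_mul, Finset.smul_sum,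
    ← Finset.sum_add_distrib]
  exact Finset.sum_congr rfl fun a ha => h a ha y

theorem Lz_add {A : Type*} [Ring A] (dl : A →ₗ[ℤ] A) (s : ℤ) (x z : A)
    (hx : Lz dl s x) (hz : Lz dl s z) : Lz dl s (x + z) := by
  intro y
  rw [add_mul, map_add, hx, hz, map_add, add_mul, add_mul, smul_add]
  abel

theorem Lz_smul {A : Type*} [Ring A] (dl : A →ₗ[ℤ] A) (s r : ℤ) (x : A)
    (hx : Lz dl s x) : Lz dl s (r • x) := by
  intro y
  rw [smul_mul_assoc, map_smul, hx, map_smul, smul_add, smul_mul_assoc, smul_mul_assoc,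
    smul_comm r s]

theorem Lz_mul {A : Type*} [Ring A] (dl : A →ₗ[ℤ] A) (s r : ℤ) (x z : A)
    (hx : Lz dl s x) (hz : Lz dl r z) : Lz dl (s * r) (x * z) := by
  intro y
  rw [mul_assoc, hx, hz, hx z, mul_add, smul_add, add_mul, mul_smul_comm, smul_smul,
    smul_mul_assoc]
  simp only [mul_assoc, add_assoc]

/-- **The internal differential squares to zero.**  For every `i, j, p`,
`Σ_{ℓ=0}^{p} Σ_{k=1}^{n} σ_i σ_k [ D(c_{ik}^ℓ) c_{kj}^{p−ℓ}
  + (−1)^{2ℓ−1+m(i)−m(k)} c_{ik}^ℓ D(c_{kj}^{p−ℓ}) ] = 0` in `𝒜_n`.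
Consequently, any ℤ-linear map `∂` with `∂ (c_{ij}^p) = D (c_{ij}^p)` on generators
and satisfying the signed Leibniz rule with respect to the grading
`|c_{ij}^p| = 2p − 1 + m i − m j` satisfies `∂ ∘ ∂ = 0`. -/
theorem stmt_3 (n : ℕ) (hn : 1 ≤ n) (m : Fin n → ℤ) :
    (∀ (i j : Fin n) (p : ℕ),
      ∑ ℓ ∈ Finset.range (p + 1), ∑ k : Fin n,
        (sgnZ (m i) * sgnZ (m k)) •
          (Dint n m i k ℓ * cGen n k j (p - ℓ) +
            sgnZ (2 * (ℓ : ℤ) - 1 + m i - m k) • (cGen n i k ℓ * Dint n m k j (p - ℓ)))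
        = 0) ∧
    (∀ dl : FreeAlgebra ℤ (IntGen n) →ₗ[ℤ] FreeAlgebra ℤ (IntGen n),
      (∀ t : IntGen n, dl (FreeAlgebra.ι ℤ t) = Dint n m t.1.1 t.1.2.1 t.1.2.2) →
      (∀ (l : List (IntGen n)) (y : FreeAlgebra ℤ (IntGen n)),
        dl ((l.map (FreeAlgebra.ι ℤ)).prod * y) =
          dl ((l.map (FreeAlgebra.ι ℤ)).prod) * y +
            sgnZ ((l.map
                (fun t : IntGen n => 2 * (t.1.2.2 : ℤ) - 1 + m t.1.1 - m t.1.2.1)).sum) •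
              ((l.map (FreeAlgebra.ι ℤ)).prod * dl y)) →
      ∀ x, dl (dl x) = 0) := by
  refine ⟨part_one n m, ?_⟩
  intro dl hd hL
  have d1 : dl 1 = 0 := by
    have := hL [] 1
    simpa [sgnZ] using this
  have Lι : ∀ t : IntGen n, Lz dl (-(sgnZ (m t.1.1) * sgnZ (m t.1.2.1))) (FreeAlgebra.ι ℤ t) := by
    intro t y
    have := hL [t] y
    simp only [List.map_cons, List.map_nil, List.prod_cons, List.prod_nil, mul_one,
      List.sum_cons, List.sum_nil, add_zero, sgnZ_deg] at this
    exact this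
  have dc : ∀ (i j : Fin n) (p : ℕ), dl (cGen n i j p) = Dint n m i j p := by
    intro i j p
    by_cases h : 1 ≤ p ∨ i < j
    · rw [cGen, dif_pos h, hd]
    · have hp : p = 0 := by omega
      subst hp
      rw [cGen_zero n i j (fun h' => h (Or.inr h')), Dint_zero n m i j (fun h' => h (Or.inr h')),
        map_zero]
  have Lc : ∀ (i j : Fin n) (p : ℕ), Lz dl (-(sgnZ (m i) * sgnZ (m j))) (cGen n i j p) := by
    intro i j p
    by_cases h : 1 ≤ p ∨ i < j
    · rw [cGen, dif_pos h]
      exact Lι ⟨(i, j, p), h⟩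
    · rw [cGen, dif_neg h]
      intro y
      simp
  have dD : ∀ (i j : Fin n) (p : ℕ), dl (Dint n m i j p) = 0 := by
    intro i j p
    rw [← part_one n m i j p, Dint, map_add]
    have : dl (if i = j ∧ p = 1 then 1 else 0) = 0 := by
      split_ifs
      · exact d1
      · exact map_zero _
    rw [this, zero_add, map_sum]
    refine Finset.sum_congr rfl fun l _ => ?_
    rw [map_sum]
    refine Finset.sum_congr rfl fun k _ => ?_
    rw [map_smul, Lc i k l, dc, dc, sgnZ_deg]
  have LD : ∀ (i j : Fin n) (p : ℕ), Lz dl (sgnZ (m i) * sgnZ (m j)) (Dint n m i j p) := by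
    intro i j p
    unfold Dint
    apply Lz_add
    · split_ifs with h
      · intro y
        rw [h.1, sgnZ_mul_self]
        simp [d1]
      · intro y
        simp
    · refine Lz_sum _ _ _ _ fun l _ => Lz_sum _ _ _ _ fun k _ => Lz_smul _ _ _ _ ?_
      have := Lz_mul dl _ _ _ _ (Lc i k l) (Lc k j (p - l))
      rwa [show -(sgnZ (m i) * sgnZ (m k)) * -(sgnZ (m k) * sgnZ (m j)) =
        sgnZ (m i) * sgnZ (m j) by
          linear_combination (sgnZ (m i) * sgnZ (m j)) * sgnZ_mul_self (m k)] at this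
  have step : ∀ (t : IntGen n) (y : FreeAlgebra ℤ (IntGen n)), dl (dl y) = 0 →
      dl (dl (FreeAlgebra.ι ℤ t * y)) = 0 := by
    intro t y hy
    rw [Lι t y, hd, map_add, LD, dD, map_smul, Lι t (dl y), hy, hd]
    simp
  have key : ∀ x y : FreeAlgebra ℤ (IntGen n), dl (dl y) = 0 → dl (dl (x * y)) = 0 := by
    intro x
    induction x using FreeAlgebra.induction with
    | grade0 r =>
      intro y hy
      rw [← Algebra.smul_def, map_smul, map_smul, hy, smul_zero]
    | grade1 t => exact step t
    | mul a b ha hb =>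
      intro y hy
      rw [mul_assoc]
      exact ha _ (hb _ hy)
    | add a b ha hb =>
      intro y hy
      rw [add_mul, map_add, map_add, ha y hy, hb y hy, add_zero]
  intro x
  have := key x 1 (by rw [d1, map_zero])
  rwa [mul_one] at this
end

section
/- Let A = ℤ⟨x₁, y₁, x₂, y₂⟩ be the free associative unital ℤ-algebra on four generators, and let I ⊆ A be the two-sided ideal generated by the five elements x₁y₁ − 1, y₁x₁ − 1, x₂y₂ − 1, y₂x₂ − 1, and x₁x₂ − x₂x₁. Then the quotient A/I is isomorphic as a ℤ-algebra to the Laurent polynomial ring in two commuting variables ℤ[x₁^{±1}, x₂^{±1}], that is, to the group algebra ℤ[ℤ²] (the monoid algebra of ℤ × ℤ over ℤ). -/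
noncomputable section

/-- The free associative unital ℤ-algebra on the four generators `x₁, y₁, x₂, y₂`. -/
abbrev A4 := FreeAlgebra ℤ (Fin 4)

def x₁ : A4 := FreeAlgebra.ι ℤ 0
def y₁ : A4 := FreeAlgebra.ι ℤ 1
def x₂ : A4 := FreeAlgebra.ι ℤ 2
def y₂ : A4 := FreeAlgebra.ι ℤ 3

/-- The group algebra of `ℤ × ℤ`. -/
abbrev LZ := AddMonoidAlgebra ℤ (ℤ × ℤ)

/-- The group-like unit of the group algebra attached to a group element. -/
def gu (g : ℤ × ℤ) : LZˣ :=
  Units.map (AddMonoidAlgebra.of ℤ (ℤ × ℤ)) (toUnits (Multiplicative.ofAdd g))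

theorem gu_val (g : ℤ × ℤ) : ((gu g : LZˣ) : LZ) = AddMonoidAlgebra.single g 1 := rfl

theorem gu_zpow (g : ℤ × ℤ) (n : ℤ) : gu g ^ n = gu (n • g) := by
  unfold gu
  rw [ofAdd_zsmul, map_zpow, map_zpow]

theorem gu_mul (g h : ℤ × ℤ) : gu g * gu h = gu (g + h) := by
  unfold gu
  rw [ofAdd_add, map_mul, map_mul]

/-- The evaluation map to the group algebra. -/
def phi : A4 →ₐ[ℤ] LZ :=
  FreeAlgebra.lift ℤ ![(gu (1, 0) : LZ), (gu (-1, 0) : LZ), (gu (0, 1) : LZ), (gu (0, -1) : LZ)]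

theorem phi_x₁ : phi x₁ = gu (1, 0) := by simp [phi, x₁]
theorem phi_y₁ : phi y₁ = gu (-1, 0) := by simp [phi, y₁]
theorem phi_x₂ : phi x₂ = gu (0, 1) := by simp [phi, x₂]
theorem phi_y₂ : phi y₂ = gu (0, -1) := by simp [phi, y₂]

theorem gu_mul_val (g h : ℤ × ℤ) : (gu g : LZ) * (gu h : LZ) = (gu (g + h) : LZ) := by
  rw [← gu_mul, Units.val_mul]

theorem gu_zero : (gu (0, 0) : LZ) = 1 := rfl

/-- Two commuting units define a homomorphism from `ℤ × ℤ`. -/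
def pairHom {Q : Type*} [Ring Q] (u v : Qˣ) (h : Commute u v) : Multiplicative (ℤ × ℤ) →* Q where
  toFun g := ((u ^ g.toAdd.1 * v ^ g.toAdd.2 : Qˣ) : Q)
  map_one' := by simp
  map_mul' a b := by
    rw [← Units.val_mul]
    congr 1
    simp only [toAdd_mul, Prod.fst_add, Prod.snd_add, zpow_add]
    have := (h.zpow_zpow b.toAdd.1 a.toAdd.2).eq
    rw [mul_assoc, mul_assoc, ← mul_assoc (u ^ b.toAdd.1), this]
    simp only [mul_assoc]

theorem equiv_aux {Q : Type*} [Ring Q] [Algebra ℤ Q] (p : A4 →ₐ[ℤ] Q)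
    (hp : Function.Surjective p) (F : Q →ₐ[ℤ] LZ) (hF : ∀ a, F (p a) = phi a)
    (h1 : p x₁ * p y₁ = 1) (h2 : p y₁ * p x₁ = 1) (h3 : p x₂ * p y₂ = 1) (h4 : p y₂ * p x₂ = 1)
    (h5 : p x₁ * p x₂ = p x₂ * p x₁) : Nonempty (Q ≃ₐ[ℤ] LZ) := by
  let u : Qˣ := ⟨p x₁, p y₁, h1, h2⟩
  let v : Qˣ := ⟨p x₂, p y₂, h3, h4⟩
  have huv : Commute u v := Units.ext h5
  let G : LZ →ₐ[ℤ] Q := AddMonoidAlgebra.lift ℤ Q (ℤ × ℤ) (pairHom u v huv)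
  have hG : ∀ a b : ℤ, G (gu (a, b) : LZ) = ((u ^ a * v ^ b : Qˣ) : Q) := by
    intro a b
    change AddMonoidAlgebra.lift ℤ Q (ℤ × ℤ) (pairHom u v huv) _ = _
    rw [gu_val, AddMonoidAlgebra.lift_single, Algebra.smul_def, map_one, one_mul]
    rfl
  have hu : Units.map (F : Q →* LZ) u = gu (1, 0) := by
    ext1
    exact (hF x₁).trans phi_x₁
  have hv : Units.map (F : Q →* LZ) v = gu (0, 1) := by
    ext1
    exact (hF x₂).trans phi_x₂
  refine ⟨AlgEquiv.ofAlgHom F G ?_ ?_⟩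
  · refine AddMonoidAlgebra.algHom_ext (fun g => ?_) (by ext)
    obtain ⟨a, b⟩ := g
    rw [← gu_val]
    change F (G _) = _
    rw [hG]
    change ((Units.map (F : Q →* LZ) (u ^ a * v ^ b) : LZˣ) : LZ) = (gu (a, b) : LZ)
    rw [map_mul, map_zpow, map_zpow, hu, hv, gu_zpow, gu_zpow, gu_mul]
    simp
  · have key : (G.comp F).comp p = p := by
      apply FreeAlgebra.hom_ext
      funext i
      change G (F (p _)) = p _
      rw [hF]
      fin_cases i
      · change G (phi x₁) = p x₁
        rw [phi_x₁, hG]; simp [u]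
      · change G (phi y₁) = p y₁
        rw [phi_y₁, hG]; simp [u]
      · change G (phi x₂) = p x₂
        rw [phi_x₂, hG]; simp [v]
      · change G (phi y₂) = p y₂
        rw [phi_y₂, hG]; simp [v]
    ext q
    obtain ⟨a, rfl⟩ := hp q
    exact DFunLike.congr_fun key a

/-- **Degree-zero Legendrian contact homology of Λ₁ (for `DT*T²`).**
The quotient of `ℤ⟨x₁, y₁, x₂, y₂⟩` by the two-sided ideal generated by
`x₁y₁ − 1, y₁x₁ − 1, x₂y₂ − 1, y₂x₂ − 1, x₁x₂ − x₂x₁` is isomorphic as a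
ℤ-algebra to the Laurent polynomial ring `ℤ[x₁^{±1}, x₂^{±1}]`, i.e. to the
group algebra `ℤ[ℤ²]` (the monoid algebra of `ℤ × ℤ` over ℤ). -/
theorem stmt_4 :
    Nonempty
      ((TwoSidedIdeal.span
          ({x₁ * y₁ - 1, y₁ * x₁ - 1, x₂ * y₂ - 1, y₂ * x₂ - 1,
            x₁ * x₂ - x₂ * x₁} : Set A4)).ringCon.Quotient ≃ₐ[ℤ]
        AddMonoidAlgebra ℤ (ℤ × ℤ)) := by
  set I := TwoSidedIdeal.span
          ({x₁ * y₁ - 1, y₁ * x₁ - 1, x₂ * y₂ - 1, y₂ * x₂ - 1,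
            x₁ * x₂ - x₂ * x₁} : Set A4) with hI
  have hle : I ≤ TwoSidedIdeal.ker phi := by
    rw [hI, TwoSidedIdeal.span_le]
    rintro z (rfl | rfl | rfl | rfl | rfl) <;>
      simp only [SetLike.mem_coe, TwoSidedIdeal.mem_ker, map_sub, map_mul, map_one, phi_x₁,
        phi_y₁, phi_x₂, phi_y₂, gu_mul_val] <;> simp [← Prod.zero_eq_mk] <;>
      simp [gu_val, AddMonoidAlgebra.one_def]
  have hker : I.ringCon ≤ RingCon.ker phi.toRingHom := by
    intro a b hab
    exact TwoSidedIdeal.ringCon_le_iff.1 hle hab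
  have hrel : ∀ a b : A4, a - b ∈ ({x₁ * y₁ - 1, y₁ * x₁ - 1, x₂ * y₂ - 1, y₂ * x₂ - 1,
            x₁ * x₂ - x₂ * x₁} : Set A4) → I.ringCon.mkₐ ℤ a = I.ringCon.mkₐ ℤ b := by
    intro a b hab
    exact Quotient.sound ((I.rel_iff a b).2 (TwoSidedIdeal.subset_span hab))
  refine equiv_aux (I.ringCon.mkₐ ℤ) Quotient.mk_surjective (I.ringCon.liftₐ phi hker)
    (fun a => rfl) ?_ ?_ ?_ ?_ ?_
  · rw [← map_mul, ← map_one (I.ringCon.mkₐ ℤ)]; exact hrel _ _ (by simp)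
  · rw [← map_mul, ← map_one (I.ringCon.mkₐ ℤ)]; exact hrel _ _ (by simp)
  · rw [← map_mul, ← map_one (I.ringCon.mkₐ ℤ)]; exact hrel _ _ (by simp)
  · rw [← map_mul, ← map_one (I.ringCon.mkₐ ℤ)]; exact hrel _ _ (by simp)
  · rw [← map_mul, ← map_mul]; exact hrel _ _ (by simp)

end
end

section
/- Let R̃(x₁, y₁, x₂, y₂) = (−½y₁, ½x₁, y₂, 2x₂) and let δ > 0. Suppose γ : ℝ → ℝ⁴ is differentiable with γ′(t) = R̃(γ(t)) for all t, and γ is periodic: there is T > 0 with γ(t + T) = γ(t) for all t. Then the third and fourth coordinates of γ vanish identically. If moreover γ(t) ∈ V_δ = {(x₁,y₁,x₂,y₂) : ½(x₁²+y₁²) + 2x₂² − y₂² = δ²} for all t, then the image of γ is exactly the circle {(x₁, y₁, 0, 0) : x₁² + y₁² = 2δ²}. In particular, there is exactly one geometric closed Reeb orbit in V_δ. -/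
lemma aux_exp (w : ℝ → ℝ) (s T : ℝ) (hs : s ≠ 0) (hT : 0 < T)
    (hw : ∀ t, HasDerivAt w (s * w t) t) (hp : ∀ t, w (t + T) = w t) (t : ℝ) : w t = 0 := by
  have hd : ∀ t, HasDerivAt (fun t => w t * Real.exp (-s * t)) 0 t := by
    intro t
    have h1 : HasDerivAt (fun t : ℝ => -s * t) (-s) t := by
      simpa using (hasDerivAt_id t).const_mul (-s)
    have h := (hw t).mul h1.exp
    refine HasDerivAt.congr_deriv (h) ?_
    ring
  have hc := is_const_of_deriv_eq_zero (fun t => (hd t).differentiableAt)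
    (fun t => (hd t).deriv) t (t + T)
  simp only [hp] at hc
  by_contra h0
  have h2 := Real.exp_injective (mul_left_cancel₀ h0 hc)
  have : s * T = 0 := by linarith
  rcases mul_eq_zero.1 this with h | h
  · exact hs h
  · exact hT.ne' h

lemma aux_angle (c s : ℝ) (h : c ^ 2 + s ^ 2 = 1) : ∃ θ : ℝ, Real.cos θ = c ∧ Real.sin θ = s := by
  have hn : ‖(⟨c, s⟩ : ℂ)‖ = 1 := by
    rw [Complex.norm_def, Complex.normSq_mk, Real.sqrt_eq_one]
    linarith
  refine ⟨Complex.arg ⟨c, s⟩, ?_, ?_⟩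
  · have := Complex.norm_mul_cos_arg ⟨c, s⟩
    rwa [hn, one_mul] at this
  · have := Complex.norm_mul_sin_arg ⟨c, s⟩
    rwa [hn, one_mul] at this


/-- **There is exactly one geometric closed Reeb orbit in `V_δ`.**
Let `R̃(x₁, y₁, x₂, y₂) = (−½y₁, ½x₁, y₂, 2x₂)` and `δ > 0`.  If `γ : ℝ → ℝ⁴`
solves `γ′ = R̃(γ)` and is periodic with period `T > 0`, then its third and
fourth coordinates vanish identically.  If moreover `γ` lies in
`V_δ = {½(x₁²+y₁²) + 2x₂² − y₂² = δ²}`, then its image is exactly the circle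
`{(x₁, y₁, 0, 0) : x₁² + y₁² = 2δ²}`. -/
theorem stmt_9 (δ : ℝ) (hδ : 0 < δ)
    (Rt : (Fin 4 → ℝ) → (Fin 4 → ℝ))
    (hRt : ∀ p, Rt p = ![-(1 / 2) * p 1, (1 / 2) * p 0, p 3, 2 * p 2])
    (γ : ℝ → (Fin 4 → ℝ))
    (hsol : ∀ t, HasDerivAt γ (Rt (γ t)) t)
    (T : ℝ) (hT : 0 < T) (hper : ∀ t, γ (t + T) = γ t) :
    (∀ t, γ t 2 = 0 ∧ γ t 3 = 0) ∧
    ((∀ t, (1 / 2) * ((γ t 0) ^ 2 + (γ t 1) ^ 2) + 2 * (γ t 2) ^ 2 - (γ t 3) ^ 2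
        = δ ^ 2) →
      Set.range γ =
        {q : Fin 4 → ℝ | q 2 = 0 ∧ q 3 = 0 ∧ (q 0) ^ 2 + (q 1) ^ 2 = 2 * δ ^ 2}) := by

  have hd := fun t => hasDerivAt_pi.1 (hsol t)
  have h0 : ∀ t, HasDerivAt (fun t => γ t 0) (-(1 / 2) * γ t 1) t := by
    intro t; simpa [hRt] using hd t 0
  have h1 : ∀ t, HasDerivAt (fun t => γ t 1) ((1 / 2) * γ t 0) t := by
    intro t; simpa [hRt] using hd t 1
  have h2 : ∀ t, HasDerivAt (fun t => γ t 2) (γ t 3) t := by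
    intro t; simpa [hRt] using hd t 2
  have h3 : ∀ t, HasDerivAt (fun t => γ t 3) (2 * γ t 2) t := by
    intro t; simpa [hRt] using hd t 3
  have hvan : ∀ t, γ t 2 = 0 ∧ γ t 3 = 0 := by
    intro t
    have hsq : √2 * √2 = (2 : ℝ) := Real.mul_self_sqrt (by norm_num)
    have hpos : 0 < √(2 : ℝ) := by positivity
    have e1 := aux_exp (fun t => γ t 3 + √2 * γ t 2) (√2) T hpos.ne' hT
      (fun t => by
        refine HasDerivAt.congr_deriv ((h3 t).add ((h2 t).const_mul (√2))) ?_
        linear_combination -γ t 2 * hsq) (fun t => by simp [hper]) t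
    have e2 := aux_exp (fun t => γ t 3 - √2 * γ t 2) (-√2) T (by simp) hT
      (fun t => by
        refine HasDerivAt.congr_deriv ((h3 t).sub ((h2 t).const_mul (√2))) ?_
        linear_combination -γ t 2 * hsq) (fun t => by simp [hper]) t
    beta_reduce at e1 e2
    have e3 : √2 * γ t 2 = 0 := by linarith
    refine ⟨(mul_eq_zero.1 e3).resolve_left hpos.ne', by linarith⟩
  refine ⟨hvan, fun hV => ?_⟩
  have hC : ∀ t, γ t 0 ^ 2 + γ t 1 ^ 2 = 2 * δ ^ 2 := by
    intro t
    have h := hV t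
    rw [(hvan t).1, (hvan t).2] at h
    linarith
  ext q
  constructor
  · rintro ⟨t, rfl⟩
    exact ⟨(hvan t).1, (hvan t).2, hC t⟩
  rintro ⟨hq2, hq3, hq⟩
  have hh : ∀ t : ℝ, HasDerivAt (fun t : ℝ => t / 2) (1 / 2) t := fun t =>
    (hasDerivAt_id t).div_const 2
  have hA : ∀ t, γ t 0 * Real.cos (t / 2) + γ t 1 * Real.sin (t / 2) = γ 0 0 := by
    have hd : ∀ t, HasDerivAt
        (fun t => γ t 0 * Real.cos (t / 2) + γ t 1 * Real.sin (t / 2)) 0 t := by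
      intro t
      refine HasDerivAt.congr_deriv (((h0 t).mul (hh t).cos).add ((h1 t).mul (hh t).sin)) ?_
      ring
    intro t
    simpa using is_const_of_deriv_eq_zero (fun t => (hd t).differentiableAt)
      (fun t => (hd t).deriv) t 0
  have hB : ∀ t, γ t 1 * Real.cos (t / 2) - γ t 0 * Real.sin (t / 2) = γ 0 1 := by
    have hd : ∀ t, HasDerivAt
        (fun t => γ t 1 * Real.cos (t / 2) - γ t 0 * Real.sin (t / 2)) 0 t := by
      intro t
      refine HasDerivAt.congr_deriv (((h1 t).mul (hh t).cos).sub ((h0 t).mul (hh t).sin)) ?_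
      ring
    intro t
    simpa using is_const_of_deriv_eq_zero (fun t => (hd t).differentiableAt)
      (fun t => (hd t).deriv) t 0
  have hab := hC 0
  generalize γ 0 0 = a at *
  generalize γ 0 1 = b at *
  have hδ2 : δ ≠ 0 := hδ.ne'
  obtain ⟨θ, hc, hs⟩ := aux_angle ((a * q 0 + b * q 1) / (2 * δ ^ 2))
    ((a * q 1 - b * q 0) / (2 * δ ^ 2)) (by
      rw [div_pow, div_pow, ← add_div, div_eq_one_iff_eq (by positivity)]
      linear_combination (q 0 ^ 2 + q 1 ^ 2) * hab + 2 * δ ^ 2 * hq)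
  rw [eq_div_iff (by positivity)] at hc hs
  have hA' := hA (2 * θ)
  have hB' := hB (2 * θ)
  rw [mul_div_cancel_left₀ _ (two_ne_zero)] at hA' hB'
  have hcs := Real.sin_sq_add_cos_sq θ
  have hne : (2 * δ ^ 2) ≠ 0 := by positivity
  refine ⟨2 * θ, ?_⟩
  have g0 : γ (2 * θ) 0 = q 0 := by
    apply mul_left_cancel₀ hne
    linear_combination (-γ (2 * θ) 0 * 2 * δ ^ 2) * hcs + 2 * δ ^ 2 * Real.cos θ * hA'
      - 2 * δ ^ 2 * Real.sin θ * hB' + a * hc - b * hs + q 0 * hab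
  have g1 : γ (2 * θ) 1 = q 1 := by
    apply mul_left_cancel₀ hne
    linear_combination (-γ (2 * θ) 1 * 2 * δ ^ 2) * hcs + 2 * δ ^ 2 * Real.sin θ * hA'
      + 2 * δ ^ 2 * Real.cos θ * hB' + b * hc + a * hs + q 1 * hab
  ext i
  fin_cases i
  · exact g0
  · exact g1
  · exact (hvan _).1.trans hq2.symm
  · exact (hvan _).2.trans hq3.symm
end

section
/- Let R̃(x₁, y₁, x₂, y₂) = (−½y₁, ½x₁, y₂, 2x₂), let δ > 0, V_δ = {½(x₁²+y₁²) + 2x₂² − y₂² = δ²}, and let Λ_st = V_δ ∩ {y₁ = 0, x₂ = 0} (the standard Legendrian strand). Suppose γ : ℝ → ℝ⁴ is differentiable with γ′ = R̃∘γ and γ(0) ∈ Λ_st, and suppose there is T > 0 such that the second and third coordinates of γ(T) vanish (γ(T) ∈ {y₁ = 0, x₂ = 0}). Then the third and fourth coordinates of γ vanish identically — so γ runs along the unique closed Reeb orbit — and T = 2πk for some positive integer k. Conversely, for every p ∈ Λ_st with fourth coordinate 0 and every positive integer k, the solution through p satisfies γ(2πk) ∈ Λ_st. Hence the Reeb chords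 of Λ_st ⊂ V_δ are exactly the iterates of the closed Reeb orbit. -/
theorem aux_const (f : ℝ → ℝ) (h : ∀ t, HasDerivAt f 0 t) (t : ℝ) : f t = f 0 :=
  is_const_of_deriv_eq_zero (fun t => (h t).differentiableAt) (fun t => (h t).deriv) t 0

theorem aux_rot (x y : ℝ → ℝ) (hx : ∀ t, HasDerivAt x (-(1 / 2) * y t) t)
    (hy : ∀ t, HasDerivAt y ((1 / 2) * x t) t) (h0 : y 0 = 0) (t : ℝ) :
    x t = x 0 * Real.cos (t / 2) ∧ y t = x 0 * Real.sin (t / 2) := by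
  have hid : ∀ t : ℝ, HasDerivAt (fun t : ℝ => t / 2) (1 / 2) t := fun t =>
    (hasDerivAt_id t).div_const 2
  have hc := fun t => (hid t).cos
  have hs := fun t => (hid t).sin
  have hA := aux_const (fun t => x t * Real.cos (t / 2) + y t * Real.sin (t / 2))
    (fun t => (((hx t).mul (hc t)).add ((hy t).mul (hs t))).congr_deriv (by ring)) t
  have hB := aux_const (fun t => y t * Real.cos (t / 2) - x t * Real.sin (t / 2))
    (fun t => (((hy t).mul (hc t)).sub ((hx t).mul (hs t))).congr_deriv (by ring)) t
  simp [h0] at hA hB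
  have h1 := Real.sin_sq_add_cos_sq (t / 2)
  constructor
  · linear_combination Real.cos (t / 2) * hA - Real.sin (t / 2) * hB - x t * h1
  · linear_combination Real.sin (t / 2) * hA + Real.cos (t / 2) * hB - y t * h1

theorem aux_hyp (x y : ℝ → ℝ) (hx : ∀ t, HasDerivAt x (y t) t)
    (hy : ∀ t, HasDerivAt y (2 * x t) t) (h0 : x 0 = 0) (t : ℝ) :
    √2 * x t + y t = y 0 * Real.exp (√2 * t) ∧
    √2 * x t - y t = - y 0 * Real.exp (-(√2 * t)) := by
  have h2 : √2 * √2 = 2 := Real.mul_self_sqrt (by norm_num)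
  have hid : ∀ t : ℝ, HasDerivAt (fun t : ℝ => √2 * t) (√2) t := fun t => by
    simpa using (hasDerivAt_id t).const_mul √2
  have hp := fun t => (hid t).exp
  have hm := fun t => (hid t).neg.exp
  have hA := aux_const (fun t => (√2 * x t + y t) * Real.exp (-(√2 * t)))
    (fun t => ((((hx t).const_mul √2).add (hy t)).mul (hm t)).congr_deriv (by
      simp only [Pi.add_apply, Pi.neg_apply]
      linear_combination (-x t * Real.exp (-(√2 * t))) * h2)) t
  have hB := aux_const (fun t => (√2 * x t - y t) * Real.exp (√2 * t))
    (fun t => ((((hx t).const_mul √2).sub (hy t)).mul (hp t)).congr_deriv (by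
      simp only [Pi.sub_apply]
      linear_combination (x t * Real.exp (√2 * t)) * h2)) t
  simp [h0] at hA hB
  have h1 : Real.exp (√2 * t) * Real.exp (-(√2 * t)) = 1 := by
    rw [← Real.exp_add]; simp
  constructor
  · linear_combination Real.exp (√2 * t) * hA - (√2 * x t + y t) * h1
  · linear_combination Real.exp (-(√2 * t)) * hB - (√2 * x t - y t) * h1

theorem aux_zero (x y : ℝ → ℝ) (hx : ∀ t, HasDerivAt x (y t) t)
    (hy : ∀ t, HasDerivAt y (2 * x t) t) (h0 : x 0 = 0) (h3 : y 0 = 0) (t : ℝ) :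
    x t = 0 ∧ y t = 0 := by
  obtain ⟨ha, hb⟩ := aux_hyp x y hx hy h0 t
  rw [h3] at ha hb
  have h2 : √2 * √2 = 2 := Real.mul_self_sqrt (by norm_num)
  constructor
  · linear_combination √2 / 4 * (ha + hb) - x t / 2 * h2
  · linear_combination (ha - hb) / 2

/-- **Reeb chords of the standard Legendrian strand are exactly the iterates of
the closed Reeb orbit.**  Let `R̃(x₁, y₁, x₂, y₂) = (−½y₁, ½x₁, y₂, 2x₂)`, `δ > 0`,
`V_δ = {½(x₁²+y₁²) + 2x₂² − y₂² = δ²}`, and let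
`Λ_st = V_δ ∩ {y₁ = 0, x₂ = 0}` be the standard Legendrian strand.  If `γ` solves
`γ′ = R̃∘γ` with `γ(0) ∈ Λ_st` and `γ(T) ∈ {y₁ = 0, x₂ = 0}` for some `T > 0`,
then the third and fourth coordinates of `γ` vanish identically and `T = 2πk` for
some positive integer `k`.  Conversely, for every `p ∈ Λ_st` with fourth
coordinate `0` and every positive integer `k`, the solution through `p` satisfies
`γ(2πk) ∈ Λ_st`. -/
theorem stmt_10 (δ : ℝ) (hδ : 0 < δ)
    (Rt : (Fin 4 → ℝ) → (Fin 4 → ℝ))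
    (hRt : ∀ p, Rt p = ![-(1 / 2) * p 1, (1 / 2) * p 0, p 3, 2 * p 2])
    (Λst : Set (Fin 4 → ℝ))
    (hΛ : Λst = {q : Fin 4 → ℝ |
      (1 / 2) * ((q 0) ^ 2 + (q 1) ^ 2) + 2 * (q 2) ^ 2 - (q 3) ^ 2 = δ ^ 2 ∧
      q 1 = 0 ∧ q 2 = 0}) :
    (∀ γ : ℝ → (Fin 4 → ℝ), (∀ t, HasDerivAt γ (Rt (γ t)) t) → γ 0 ∈ Λst →
      ∀ T : ℝ, 0 < T → γ T 1 = 0 → γ T 2 = 0 →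
        (∀ t, γ t 2 = 0 ∧ γ t 3 = 0) ∧
          ∃ k : ℕ, 0 < k ∧ T = 2 * Real.pi * k) ∧
    (∀ p : Fin 4 → ℝ, p ∈ Λst → p 3 = 0 → ∀ k : ℕ, 0 < k →
      ∀ γ : ℝ → (Fin 4 → ℝ), (∀ t, HasDerivAt γ (Rt (γ t)) t) → γ 0 = p →
        γ (2 * Real.pi * k) ∈ Λst) := by
  subst hΛ
  have key : ∀ γ : ℝ → (Fin 4 → ℝ), (∀ t, HasDerivAt γ (Rt (γ t)) t) →
      (∀ t, HasDerivAt (fun t => γ t 0) (-(1 / 2) * γ t 1) t) ∧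
      (∀ t, HasDerivAt (fun t => γ t 1) ((1 / 2) * γ t 0) t) ∧
      (∀ t, HasDerivAt (fun t => γ t 2) (γ t 3) t) ∧
      (∀ t, HasDerivAt (fun t => γ t 3) (2 * γ t 2) t) := by
    intro γ h
    have h' := fun t => hasDerivAt_pi.1 (h t)
    simp only [hRt] at h'
    exact ⟨fun t => h' t 0, fun t => h' t 1, fun t => h' t 2, fun t => h' t 3⟩
  constructor
  · rintro γ hγ ⟨hV, h1, h2⟩ T hT hT1 hT2
    obtain ⟨d0, d1, d2, d3⟩ := key γ hγ
    have h3 : γ 0 3 = 0 := by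
      obtain ⟨ha, hb⟩ := aux_hyp _ _ d2 d3 h2 T
      simp only [hT2] at ha hb
      have hlt : Real.exp (-(√2 * T)) < Real.exp (√2 * T) := by
        apply Real.exp_lt_exp.2
        have : 0 < √2 * T := by positivity
        linarith
      have hz : γ 0 3 * (Real.exp (√2 * T) - Real.exp (-(√2 * T))) = 0 := by
        linear_combination -ha - hb
      rcases mul_eq_zero.1 hz with h | h
      · exact h
      · linarith
    refine ⟨fun t => aux_zero _ _ d2 d3 h2 h3 t, ?_⟩
    have hy := (aux_rot _ _ d0 d1 h1 T).2
    simp only [hT1] at hy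
    have hx0 : γ 0 0 ≠ 0 := by
      intro h
      rw [h, h1, h2, h3] at hV
      have : 0 < δ ^ 2 := by positivity
      linarith
    have hs : Real.sin (T / 2) = 0 := by
      rcases mul_eq_zero.1 hy.symm with h | h
      · exact absurd h hx0
      · exact h
    obtain ⟨n, hn⟩ := Real.sin_eq_zero_iff.1 hs
    have hnpos : 0 < n := by
      have : (0 : ℝ) < n * Real.pi := by rw [hn]; linarith
      have := pos_of_mul_pos_left this Real.pi_pos.le
      exact_mod_cast this
    lift n to ℕ using hnpos.le
    refine ⟨n, by exact_mod_cast hnpos, ?_⟩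
    push_cast at hn
    linarith
  · rintro p ⟨hV, h1, h2⟩ h3 k hk γ hγ rfl
    obtain ⟨d0, d1, d2, d3⟩ := key γ hγ
    obtain ⟨hx, hy⟩ := aux_rot _ _ d0 d1 h1 (2 * Real.pi * k)
    obtain ⟨e2, e3⟩ := aux_zero _ _ d2 d3 h2 h3 (2 * Real.pi * k)
    have ht : 2 * Real.pi * k / 2 = k * Real.pi := by ring
    rw [ht] at hx hy
    rw [Real.sin_nat_mul_pi] at hy
    have hc : Real.cos (k * Real.pi) ^ 2 = 1 := by
      have := Real.sin_sq_add_cos_sq (k * Real.pi)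
      rw [Real.sin_nat_mul_pi] at this
      linarith
    simp only [mul_zero] at hx hy e2 e3
    refine ⟨?_, hy, e2⟩
    rw [hx, hy, e2, e3]
    rw [h1, h2, h3] at hV
    linear_combination hV + (1 / 2) * (γ 0 0) ^ 2 * hc
end

section
/- Let a > 0, p > 0 and C > 0 be real numbers such that |a − n/m| ≥ C·m^{-p} for all integers n and all integers m ≥ 1. Then there exists K > 0 such that for all real ε with 0 < ε < 1, all real T ≥ 1, and all natural numbers n, m with |T − 2πn| < ε and |T − 2πam| < ε, one has T ≥ K·ε^{-1/p}. -/
/-- **Return times to a small ball are at least `K·ε^{-1/p}`.**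
Let `a, p, C > 0` with `|a − n/m| ≥ C·m^{−p}` for all integers `n` and all
integers `m ≥ 1` (i.e. `a` has Liouville–Roth exponent at most `p` with
constant `C`).  Then there is `K > 0` such that for all `0 < ε < 1`, all
`T ≥ 1`, and all naturals `n, m` with `|T − 2πn| < ε` and `|T − 2πam| < ε`,
one has `T ≥ K·ε^{−1/p}`. -/
theorem stmt_12 (a p C : ℝ) (ha : 0 < a) (hp : 0 < p) (hC : 0 < C)
    (hirr : ∀ n m : ℤ, 1 ≤ m → C * (m : ℝ) ^ (-p) ≤ |a - (n : ℝ) / (m : ℝ)|) :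
    ∃ K : ℝ, 0 < K ∧ ∀ ε T : ℝ, 0 < ε → ε < 1 → 1 ≤ T →
      ∀ n m : ℕ, |T - 2 * Real.pi * n| < ε → |T - 2 * Real.pi * a * m| < ε →
        K * ε ^ (-1 / p) ≤ T := by
  have hpi := Real.pi_gt_three
  refine ⟨Real.pi * a * C ^ (1 / p), by positivity, ?_⟩
  intro ε T hε hε1 hT n m hn hm
  have hm1 : 1 ≤ m := by
    rcases Nat.eq_zero_or_pos m with h | h
    · subst h
      simp only [Nat.cast_zero, mul_zero, sub_zero] at hm
      have := le_abs_self T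
      linarith
    · exact h
  have hmR : (1 : ℝ) ≤ m := by exact_mod_cast hm1
  have hm0 : (0 : ℝ) < m := by linarith
  rw [abs_lt] at hn hm
  have key : |a * m - n| < ε := by
    rw [abs_lt]
    constructor <;> nlinarith [hn.1, hn.2, hm.1, hm.2]
  have key2 : |a - (n : ℝ) / m| < ε := by
    have h1 : a - (n : ℝ) / m = (a * m - n) / m := by field_simp
    rw [h1, abs_div, abs_of_pos hm0, div_lt_iff₀ hm0]
    nlinarith
  have h2 := hirr n m (by exact_mod_cast hm1)
  simp only [Int.cast_natCast] at h2
  have h3 : C * (m : ℝ) ^ (-p) < ε := lt_of_le_of_lt h2 key2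
  have hmp : (0 : ℝ) < (m : ℝ) ^ p := Real.rpow_pos_of_pos hm0 p
  have h4 : C * ε⁻¹ ≤ (m : ℝ) ^ p := by
    rw [Real.rpow_neg hm0.le, ← div_eq_mul_inv, div_lt_iff₀ hmp] at h3
    rw [← div_eq_mul_inv, div_le_iff₀ hε]
    linarith
  have h5 : (C * ε⁻¹) ^ (1 / p) ≤ m := by
    have h := Real.rpow_le_rpow (by positivity) h4 (by positivity : 0 ≤ 1 / p)
    rwa [← Real.rpow_mul hm0.le, mul_one_div_cancel hp.ne', Real.rpow_one] at h
  have h6 : (C * ε⁻¹) ^ (1 / p) = C ^ (1 / p) * ε ^ (-1 / p) := by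
    rw [Real.mul_rpow hC.le (by positivity), Real.inv_rpow hε.le, ← Real.rpow_neg hε.le, neg_div]
  rw [h6] at h5
  have h7 : Real.pi * a * (C ^ (1 / p) * ε ^ (-1 / p)) ≤ Real.pi * a * m :=
    mul_le_mul_of_nonneg_left h5 (by positivity)
  linarith [hm.1]
end

section
/- Let 𝔽₂ = ℤ/2ℤ and let A be the free associative unital 𝔽₂-algebra on generators a₁, …, a₉ together with two families of internal generators: c₁₂⁰ and c_{ij}^p (1 ≤ i,j ≤ 2, p ≥ 1), and c̃₁₂⁰ and c̃_{ij}^p (1 ≤ i,j ≤ 2, p ≥ 1), with the convention c_{ij}^0 = c̃_{ij}^0 = 0 for i ≥ j. Define ∂ on generators by: ∂a₁ = a₂a₃ + c₁₂⁰a₅, ∂a₄ = 1 + a₅a₇, ∂a₆ = 1 + c̃₁₂⁰a₇, ∂a₈ = c₁₂⁰ + a₃, ∂a₉ = c̃₁₂⁰ + a₂, ∂a_i = 0 for i ∈ {2,3,5,7}, ∂c₁₂⁰ = ∂c̃₁₂⁰ = 0, and on each internal family by ∂(c_{ij}^p) = δ_{ij}δ_{p,1} + Σ_{ℓ=0}^{p}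 Σ_{k=1}^{2} c_{ik}^ℓ c_{kj}^{p−ℓ} (and the same formula with tildes). Let ε : A → 𝔽₂ be the unique 𝔽₂-algebra homomorphism with ε(a₂) = ε(a₃) = ε(a₅) = ε(a₇) = ε(c₁₂⁰) = ε(c̃₁₂⁰) = ε(c₂₁¹) = ε(c̃₂₁¹) = 1 and ε(g) = 0 on every other generator g. Then ε(∂g) = 0 for every generator g of A; hence ε is an augmentation of the DGA (A, ∂). -/
noncomputable section

/-- Index type for the internal generators `c_{ij}^p` of one 1-handle with two
strands: `p ≥ 1`, or `p = 0` and `i < j`. -/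
abbrev HGen2 := {t : Fin 2 × Fin 2 × ℕ // 1 ≤ t.2.2 ∨ t.1 < t.2.1}

/-- Generators of the DGA of the torus-example knot in `#²(S¹×S²)`:
the crossings `a₁, …, a₉` and two families of internal generators. -/
abbrev Gen16 := Fin 9 ⊕ (HGen2 ⊕ HGen2)

/-- The DGA of the torus-example knot, over `𝔽₂ = ℤ/2`. -/
abbrev A16 := FreeAlgebra (ZMod 2) Gen16

/-- The crossing generator `a_{k+1}`. -/
def aa16 (k : Fin 9) : A16 := FreeAlgebra.ι (ZMod 2) (Sum.inl k)

/-- The internal generator `c_{(i+1)(j+1)}^p` of the first handle, with the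
convention `c_{ij}^0 = 0` for `i ≥ j`. -/
def cc16 (i j : Fin 2) (p : ℕ) : A16 :=
  if h : 1 ≤ p ∨ i < j then
    FreeAlgebra.ι (ZMod 2) (Sum.inr (Sum.inl ⟨(i, j, p), h⟩)) else 0

/-- The internal generator `c̃_{(i+1)(j+1)}^p` of the second handle. -/
def ct16 (i j : Fin 2) (p : ℕ) : A16 :=
  if h : 1 ≤ p ∨ i < j then
    FreeAlgebra.ι (ZMod 2) (Sum.inr (Sum.inr ⟨(i, j, p), h⟩)) else 0

/-- The value of the differential `∂` on each generator. -/
def D16 : Gen16 → A16 := fun gIdx =>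
  match gIdx with
  | Sum.inl k =>
      if k = 0 then aa16 1 * aa16 2 + cc16 0 1 0 * aa16 4       -- ∂a₁ = a₂a₃ + c₁₂⁰a₅
      else if k = 3 then 1 + aa16 4 * aa16 6                    -- ∂a₄ = 1 + a₅a₇
      else if k = 5 then 1 + ct16 0 1 0 * aa16 6                -- ∂a₆ = 1 + c̃₁₂⁰a₇
      else if k = 7 then cc16 0 1 0 + aa16 2                    -- ∂a₈ = c₁₂⁰ + a₃
      else if k = 8 then ct16 0 1 0 + aa16 1                    -- ∂a₉ = c̃₁₂⁰ + a₂
      else 0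
  | Sum.inr (Sum.inl t) =>
      (if t.1.1 = t.1.2.1 ∧ t.1.2.2 = 1 then 1 else 0) +
        ∑ ℓ ∈ Finset.range (t.1.2.2 + 1), ∑ k : Fin 2,
          cc16 t.1.1 k ℓ * cc16 k t.1.2.1 (t.1.2.2 - ℓ)
  | Sum.inr (Sum.inr t) =>
      (if t.1.1 = t.1.2.1 ∧ t.1.2.2 = 1 then 1 else 0) +
        ∑ ℓ ∈ Finset.range (t.1.2.2 + 1), ∑ k : Fin 2,
          ct16 t.1.1 k ℓ * ct16 k t.1.2.1 (t.1.2.2 - ℓ)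

/-- The value of the augmentation on each generator: `1` on
`a₂, a₃, a₅, a₇, c₁₂⁰, c̃₁₂⁰, c₂₁¹, c̃₂₁¹` and `0` on all other generators. -/
def εgen16 : Gen16 → ZMod 2 := fun gIdx =>
  match gIdx with
  | Sum.inl k => if k = 1 ∨ k = 2 ∨ k = 4 ∨ k = 6 then 1 else 0
  | Sum.inr (Sum.inl t) =>
      if t.1 = ((0 : Fin 2), (1 : Fin 2), (0 : ℕ)) ∨
         t.1 = ((1 : Fin 2), (0 : Fin 2), (1 : ℕ)) then 1 else 0
  | Sum.inr (Sum.inr t) =>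
      if t.1 = ((0 : Fin 2), (1 : Fin 2), (0 : ℕ)) ∨
         t.1 = ((1 : Fin 2), (0 : Fin 2), (1 : ℕ)) then 1 else 0

/-- Value of the augmentation on `c_{ij}^p`, including the zero convention. -/
def e16 (i j : Fin 2) (p : ℕ) : ZMod 2 :=
  if (i, j, p) = ((0 : Fin 2), (1 : Fin 2), (0 : ℕ)) ∨
     (i, j, p) = ((1 : Fin 2), (0 : Fin 2), (1 : ℕ)) then 1 else 0

theorem e16_big (i j : Fin 2) (p : ℕ) (hp : 2 ≤ p) : e16 i j p = 0 := by
  unfold e16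
  rw [if_neg]
  simp only [Prod.mk.injEq]
  omega

theorem e16_sum (i j : Fin 2) (p : ℕ) :
    (if i = j ∧ p = 1 then (1 : ZMod 2) else 0) +
      ∑ ℓ ∈ Finset.range (p + 1), ∑ k : Fin 2, e16 i k ℓ * e16 k j (p - ℓ) = 0 := by
  by_cases hp : 3 ≤ p
  · rw [if_neg (by omega), zero_add]
    refine Finset.sum_eq_zero fun ℓ _ => Finset.sum_eq_zero fun k _ => ?_
    by_cases hl : 2 ≤ ℓ
    · rw [e16_big i k ℓ hl, zero_mul]
    · rw [e16_big k j (p - ℓ) (by omega), mul_zero]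
  · have : p < 3 := by omega
    interval_cases p <;> revert i j <;> decide

/-- **The DGA of the torus-example knot has an augmentation over `ℤ/2`:**
the algebra map `ε` determined by `εgen16` on generators kills the differential of
every generator; hence `ε` is a graded augmentation of `(A, ∂)`. -/
theorem stmt_16 (ε : A16 →ₐ[ZMod 2] ZMod 2)
    (hε : ∀ gIdx : Gen16, ε (FreeAlgebra.ι (ZMod 2) gIdx) = εgen16 gIdx) :
    ∀ gIdx : Gen16, ε (D16 gIdx) = 0 := by
  have ha : ∀ k, ε (aa16 k) = if k = 1 ∨ k = 2 ∨ k = 4 ∨ k = 6 then 1 else 0 :=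
    fun k => hε _
  have hc : ∀ i j p, ε (cc16 i j p) = e16 i j p := by
    intro i j p
    unfold cc16
    split_ifs with h
    · exact hε _
    · obtain rfl : p = 0 := by omega
      rw [map_zero]
      revert h; revert i j; decide
  have ht : ∀ i j p, ε (ct16 i j p) = e16 i j p := by
    intro i j p
    unfold ct16
    split_ifs with h
    · exact hε _
    · obtain rfl : p = 0 := by omega
      rw [map_zero]
      revert h; revert i j; decide
  rintro (k | t | t)
  · simp only [D16]
    split_ifs <;> simp only [map_add, map_mul, map_one, map_zero, ha, hc, ht] <;> decide
  · simp only [D16, map_add, map_sum, map_mul, hc, apply_ite ε, map_one, map_zero]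
    exact e16_sum _ _ _
  · simp only [D16, map_add, map_sum, map_mul, ht, apply_ite ε, map_one, map_zero]
    exact e16_sum _ _ _

end
end

section
/- Let 𝔽₂ = ℤ/2ℤ. Let A be the free associative unital 𝔽₂-algebra on generators a₁, …, a₁₂, d₁₂, d₁₃, d₂₃, and internal generators c_{ij}^p for 1 ≤ i,j ≤ 3 (p ≥ 1, and p = 0 only for i < j), with the convention c_{ij}^0 = 0 for i ≥ j. Define ∂ on generators by: ∂a₁ = 1 + a₅a₄ + (1 + a₉a₁₁)a₆ + a₉c₁₂⁰; ∂a₂ = (1 + a₃a₅)a₄ + a₃(1 + a₉a₁₁)a₆ + a₃a₉c₁₂⁰; ∂a₇ = 1 + a₁₁a₁₀ + c₁₂⁰a₁₂ + c₁₃⁰; ∂a₈ = (1 + a₉a₁₁)a₁₀ + a₉c₁₂⁰a₁₂ + a₉c₁₃⁰; ∂a₁₂ = c₂₃⁰; ∂d₁₂ = c₁₂⁰ + 1 + a₃a₅; ∂d₁₃ = c₁₃⁰ + d₁₂c₂₃⁰ + (1 + a₃a₅)d₂₃ + a₃(1 + a₉a₁₁); ∂g = 0 for all other non-internal generators g; and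 ∂(c_{ij}^p) = δ_{ij}δ_{p,1} + Σ_{ℓ=0}^{p} Σ_{k=1}^{3} c_{ik}^ℓ c_{kj}^{p−ℓ} on internal generators. Let A′ = 𝔽₂⟨a, b, c, d⟩ be the free 𝔽₂-algebra on four generators, and let φ : A → A′ be the 𝔽₂-algebra homomorphism with φ(c₁₂⁰) = a, φ(c₁₃⁰) = d, φ(c₂₁¹) = c, φ(c₃₁¹) = b, φ(a₃) = φ(a₄) = φ(a₉) = φ(a₁₀) = 1, φ(a₅) = a + 1, φ(a₁₁) = d + 1, and φ(g) = 0 for all other generators g. Let I ⊆ A′ be the two-sided ideal generated by {1 + ac + db, 1 + ca, 1 + bd, ba, cd}. Then for every generator g of A, φ(∂g) ∈ I; consequently φ descends to a chain map from (A, ∂) to (A′/I, 0). -/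
noncomputable section

/-- Index type for the internal generators `c_{ij}^p` of a 1-handle with three
strands: `p ≥ 1`, or `p = 0` and `i < j`. -/
abbrev HGen3 := {t : Fin 3 × Fin 3 × ℕ // 1 ≤ t.2.2 ∨ t.1 < t.2.1}

/-- Generators of the DGA of the exotic-`ℝ⁸` knot `Λ ⊂ S¹×S²`:
crossings `a₁, …, a₁₂`, the crossings `d₁₂, d₁₃, d₂₃`, and the internal
generators of the single 1-handle. -/
abbrev Gen17 := Fin 12 ⊕ (Fin 3 ⊕ HGen3)

/-- The DGA of the exotic-`ℝ⁸` knot, over `𝔽₂ = ℤ/2`. -/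
abbrev A17 := FreeAlgebra (ZMod 2) Gen17

/-- The crossing generator `a_{k+1}`. -/
def aa17 (k : Fin 12) : A17 := FreeAlgebra.ι (ZMod 2) (Sum.inl k)

/-- The generators `d₁₂ = dd17 0`, `d₁₃ = dd17 1`, `d₂₃ = dd17 2`. -/
def dd17 (k : Fin 3) : A17 := FreeAlgebra.ι (ZMod 2) (Sum.inr (Sum.inl k))

/-- The internal generator `c_{(i+1)(j+1)}^p`, with the convention
`c_{ij}^0 = 0` for `i ≥ j`. -/
def cc17 (i j : Fin 3) (p : ℕ) : A17 :=
  if h : 1 ≤ p ∨ i < j then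
    FreeAlgebra.ι (ZMod 2) (Sum.inr (Sum.inr ⟨(i, j, p), h⟩)) else 0

/-- The value of the differential `∂` on each generator. -/
def D17 : Gen17 → A17 := fun gIdx =>
  match gIdx with
  | Sum.inl k =>
      -- ∂a₁ = 1 + a₅a₄ + (1 + a₉a₁₁)a₆ + a₉c₁₂⁰
      if k = 0 then 1 + aa17 4 * aa17 3 + (1 + aa17 8 * aa17 10) * aa17 5 +
        aa17 8 * cc17 0 1 0
      -- ∂a₂ = (1 + a₃a₅)a₄ + a₃(1 + a₉a₁₁)a₆ + a₃a₉c₁₂⁰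
      else if k = 1 then (1 + aa17 2 * aa17 4) * aa17 3 +
        aa17 2 * (1 + aa17 8 * aa17 10) * aa17 5 + aa17 2 * aa17 8 * cc17 0 1 0
      -- ∂a₇ = 1 + a₁₁a₁₀ + c₁₂⁰a₁₂ + c₁₃⁰
      else if k = 6 then 1 + aa17 10 * aa17 9 + cc17 0 1 0 * aa17 11 + cc17 0 2 0
      -- ∂a₈ = (1 + a₉a₁₁)a₁₀ + a₉c₁₂⁰a₁₂ + a₉c₁₃⁰
      else if k = 7 then (1 + aa17 8 * aa17 10) * aa17 9 +
        aa17 8 * cc17 0 1 0 * aa17 11 + aa17 8 * cc17 0 2 0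
      -- ∂a₁₂ = c₂₃⁰
      else if k = 11 then cc17 1 2 0
      else 0
  | Sum.inr (Sum.inl k) =>
      -- ∂d₁₂ = c₁₂⁰ + 1 + a₃a₅
      if k = 0 then cc17 0 1 0 + 1 + aa17 2 * aa17 4
      -- ∂d₁₃ = c₁₃⁰ + d₁₂c₂₃⁰ + (1 + a₃a₅)d₂₃ + a₃(1 + a₉a₁₁)
      else if k = 1 then cc17 0 2 0 + dd17 0 * cc17 1 2 0 +
        (1 + aa17 2 * aa17 4) * dd17 2 + aa17 2 * (1 + aa17 8 * aa17 10)
      else 0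
  | Sum.inr (Sum.inr t) =>
      (if t.1.1 = t.1.2.1 ∧ t.1.2.2 = 1 then 1 else 0) +
        ∑ ℓ ∈ Finset.range (t.1.2.2 + 1), ∑ k : Fin 3,
          cc17 t.1.1 k ℓ * cc17 k t.1.2.1 (t.1.2.2 - ℓ)

/-- The free `𝔽₂`-algebra `A′ = 𝔽₂⟨a, b, c, d⟩` on four generators. -/
abbrev A17' := FreeAlgebra (ZMod 2) (Fin 4)

/-- The generators `a, b, c, d` of `A′`. -/
def gA : A17' := FreeAlgebra.ι (ZMod 2) 0
def gB : A17' := FreeAlgebra.ι (ZMod 2) 1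
def gC : A17' := FreeAlgebra.ι (ZMod 2) 2
def gD : A17' := FreeAlgebra.ι (ZMod 2) 3

/-- The value of `φ` on each generator of `A`:
`φ(c₁₂⁰) = a`, `φ(c₁₃⁰) = d`, `φ(c₂₁¹) = c`, `φ(c₃₁¹) = b`,
`φ(a₃) = φ(a₄) = φ(a₉) = φ(a₁₀) = 1`, `φ(a₅) = a + 1`, `φ(a₁₁) = d + 1`,
and `φ = 0` on all other generators. -/
def φgen17 : Gen17 → A17' := fun gIdx =>
  match gIdx with
  | Sum.inl k =>
      if k = 2 ∨ k = 3 ∨ k = 8 ∨ k = 9 then 1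
      else if k = 4 then gA + 1
      else if k = 10 then gD + 1
      else 0
  | Sum.inr (Sum.inl _) => 0
  | Sum.inr (Sum.inr t) =>
      if t.1 = ((0 : Fin 3), (1 : Fin 3), (0 : ℕ)) then gA
      else if t.1 = ((0 : Fin 3), (2 : Fin 3), (0 : ℕ)) then gD
      else if t.1 = ((1 : Fin 3), (0 : Fin 3), (1 : ℕ)) then gC
      else if t.1 = ((2 : Fin 3), (0 : Fin 3), (1 : ℕ)) then gB
      else 0

lemma phi_cc17 (φ : A17 →ₐ[ZMod 2] A17')
    (hφ : ∀ gIdx : Gen17, φ (FreeAlgebra.ι (ZMod 2) gIdx) = φgen17 gIdx)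
    (i j : Fin 3) (p : ℕ) : φ (cc17 i j p) =
      if i = 0 ∧ j = 1 ∧ p = 0 then gA
      else if i = 0 ∧ j = 2 ∧ p = 0 then gD
      else if i = 1 ∧ j = 0 ∧ p = 1 then gC
      else if i = 2 ∧ j = 0 ∧ p = 1 then gB
      else 0 := by
  unfold cc17
  by_cases h : 1 ≤ p ∨ i < j
  · rw [dif_pos h, hφ]
    simp only [φgen17, Prod.mk.injEq]
  · rw [dif_neg h, map_zero, if_neg, if_neg, if_neg, if_neg]
    · rintro ⟨rfl, rfl, rfl⟩; exact h (Or.inl le_rfl)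
    · rintro ⟨rfl, rfl, rfl⟩; exact h (Or.inl le_rfl)
    · rintro ⟨rfl, rfl, rfl⟩; exact h (Or.inr (by decide))
    · rintro ⟨rfl, rfl, rfl⟩; exact h (Or.inr (by decide))

/-- The image of `c_{ij}^p` vanishes for `p ≥ 2`. -/
lemma phi_cc17_ge (φ : A17 →ₐ[ZMod 2] A17')
    (hφ : ∀ gIdx : Gen17, φ (FreeAlgebra.ι (ZMod 2) gIdx) = φgen17 gIdx)
    (i j : Fin 3) (p : ℕ) (h : 2 ≤ p) : φ (cc17 i j p) = 0 := by
  rw [phi_cc17 φ hφ, if_neg (by omega), if_neg (by omega), if_neg (by omega), if_neg (by omega)]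

/-- In superscript one only the column `j = 1` has nonzero image, and its rows are `2, 3`. -/
lemma phi_cc17_one_mul (φ : A17 →ₐ[ZMod 2] A17')
    (hφ : ∀ gIdx : Gen17, φ (FreeAlgebra.ι (ZMod 2) gIdx) = φgen17 gIdx)
    (i k j : Fin 3) : φ (cc17 i k 1) * φ (cc17 k j 1) = 0 := by
  rw [phi_cc17 φ hφ, phi_cc17 φ hφ]
  by_cases hk : k = 0 <;> by_cases hk' : k = 1 <;> by_cases hk'' : k = 2 <;> simp_all

lemma add_self17 (x : A17') : x + x = 0 := by
  have h : (2 : ZMod 2) • x = 0 := by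
    rw [show (2 : ZMod 2) = 0 from rfl, zero_smul]
  rwa [two_smul] at h

set_option maxHeartbeats 4000000 in
/-- **`φ` is a chain map to `(A′/I, 0)`:** for every generator `g` of the DGA
`(A, ∂)` of the exotic-`ℝ⁸` knot, `φ(∂g)` lies in the two-sided ideal `I` of
`A′ = 𝔽₂⟨a,b,c,d⟩` generated by `1 + ac + db`, `1 + ca`, `1 + bd`, `ba`, `cd`;
consequently `φ` descends to a chain map from `(A, ∂)` to `(A′/I, 0)`. -/
theorem stmt_17 (φ : A17 →ₐ[ZMod 2] A17')
    (hφ : ∀ gIdx : Gen17, φ (FreeAlgebra.ι (ZMod 2) gIdx) = φgen17 gIdx) :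
    ∀ gIdx : Gen17, φ (D17 gIdx) ∈
      TwoSidedIdeal.span
        ({1 + gA * gC + gD * gB, 1 + gC * gA, 1 + gB * gD, gB * gA, gC * gD} :
          Set A17') := by
  have hc := phi_cc17 φ hφ
  have ha : ∀ k, φ (aa17 k) = φgen17 (Sum.inl k) := fun k => hφ _
  have hd : ∀ k, φ (dd17 k) = 0 := fun k => hφ _
  have h1 := add_self17 1
  have hA := add_self17 gA
  have hD := add_self17 gD
  set I := TwoSidedIdeal.span
        ({1 + gA * gC + gD * gB, 1 + gC * gA, 1 + gB * gD, gB * gA, gC * gD} :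
          Set A17') with hI
  have key : ∀ x ∈ ({1 + gA * gC + gD * gB, 1 + gC * gA, 1 + gB * gD, gB * gA, gC * gD} :
          Set A17'), x ∈ I := fun x hx => TwoSidedIdeal.subset_span hx
  have m1 := key (1 + gA * gC + gD * gB) (by simp)
  have m2 := key (1 + gC * gA) (by simp)
  have m3 := key (1 + gB * gD) (by simp)
  have m4 := key (gB * gA) (by simp)
  have m5 := key (gC * gD) (by simp)
  have m0 : (0 : A17') ∈ I := I.zero_mem
  clear_value I
  rintro (k | k | ⟨⟨i, j, p⟩, hp⟩)
  · suffices h : φ (D17 (Sum.inl k)) = 0 by rw [h]; exact m0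
    fin_cases k <;> simp [D17, hc, ha, φgen17] <;> grind
  · suffices h : φ (D17 (Sum.inr (Sum.inl k))) = 0 by rw [h]; exact m0
    fin_cases k <;> simp [D17, hc, ha, hd, φgen17] <;> grind
  · rcases p with _ | _ | p
    · fin_cases i <;> fin_cases j <;>
        simp [D17, hc, Fin.sum_univ_three, m0]
    · fin_cases i <;> fin_cases j <;>
        simp [D17, hc, Fin.sum_univ_three, Finset.sum_range_succ, m0, m2, m3, m4, m5]
      simpa [add_assoc] using m1
    · have h : φ (D17 (Sum.inr (Sum.inr ⟨(i, j, p + 2), hp⟩))) = 0 := by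
        simp only [D17, map_add, map_sum, map_mul]
        rw [if_neg (fun h => by have := h.2; omega), map_zero, zero_add]
        refine Finset.sum_eq_zero fun l _ => Finset.sum_eq_zero fun k _ => ?_
        by_cases h2 : 2 ≤ l
        · rw [phi_cc17_ge φ hφ _ _ _ h2, zero_mul]
        · by_cases h3 : 2 ≤ p + 2 - l
          · rw [phi_cc17_ge φ hφ _ _ _ h3, mul_zero]
          · obtain ⟨rfl, rfl⟩ : l = 1 ∧ p = 0 := by omega
            exact phi_cc17_one_mul φ hφ _ _ _
      rw [h]; exact m0

end
end

section
/- Fix n ≥ 1, a sign η ∈ {1, −1}, and a function σ : ℤ → {1, −1} with σ(m + n) = σ(m) for all m. Let A be the free associative unital ℤ-algebra on generators a_q (q ≥ 1), b_q (q ≥ n + 1), and c_{ij}^p (1 ≤ i, j ≤ n, p ≥ 1, together with p = 0 for i < j); for integers α < β write c_{αβ} := c_{α₂β₂}^{β₁−α₁} where α = α₁n + α₂, β = β₁n + β₂ with 1 ≤ α₂, β₂ ≤ n, and set c_{αβ} := 0 for α ≥ β. For each s ≥ n + 1 let ψ_s : A → A be the algebra endomorphism with ψ_s(a_q) = a_q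 − η·σ(s)·b_s·c_{s, q+n} for all 1 ≤ q ≤ s, and ψ_s equal to the identity on all other generators. Then for every s ≥ n + 1 and every q ≥ 1, (ψ_s ∘ ψ_{s−1} ∘ ⋯ ∘ ψ_{n+1})(a_q) = a_q − Σ_{m = max(q, n+1)}^{min(s, q+n−1)} η·σ(m)·b_m·c_{m, q+n}, the sum being empty when min(s, q+n−1) < max(q, n+1); in particular the value stabilizes for s ≥ q + n − 1 at a_q − Σ_{m = max(q, n+1)}^{q+n−1} η·σ(m)·b_m·c_{m, q+n}. -/
noncomputable section

/-- Index type for the generators `a_q`, `q ≥ 1`. -/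
abbrev GenA18 := {q : ℕ // 1 ≤ q}

/-- Index type for the generators `b_q`, `q ≥ n + 1`. -/
abbrev GenB18 (n : ℕ) := {q : ℕ // n + 1 ≤ q}

/-- Index type for the generators `c_{ij}^p`, `1 ≤ i, j ≤ n`, with `p ≥ 1` or
(`p = 0` and `i < j`). -/
abbrev GenC18 (n : ℕ) :=
  {t : ℕ × ℕ × ℕ //
    1 ≤ t.1 ∧ t.1 ≤ n ∧ 1 ≤ t.2.1 ∧ t.2.1 ≤ n ∧ (1 ≤ t.2.2 ∨ t.1 < t.2.1)}

/-- The generators of the free ℤ-algebra `A`. -/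
abbrev Gen18 (n : ℕ) := GenA18 ⊕ (GenB18 n ⊕ GenC18 n)

/-- The free associative unital ℤ-algebra on the generators `a_q`, `b_q`,
`c_{ij}^p`. -/
abbrev A18 (n : ℕ) := FreeAlgebra ℤ (Gen18 n)

/-- The generator `a_q` (and `0` for out-of-range indices). -/
def aGen (n q : ℕ) : A18 n :=
  if h : 1 ≤ q then FreeAlgebra.ι ℤ (Sum.inl ⟨q, h⟩) else 0

/-- The generator `b_q` (and `0` for out-of-range indices). -/
def bGen (n q : ℕ) : A18 n :=
  if h : n + 1 ≤ q then FreeAlgebra.ι ℤ (Sum.inr (Sum.inl ⟨q, h⟩)) else 0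

/-- The generator `c_{ij}^p` (and `0` for out-of-range indices; in particular
`c_{ij}^0 = 0` for `i ≥ j`). -/
def cGen18 (n i j p : ℕ) : A18 n :=
  if h : 1 ≤ i ∧ i ≤ n ∧ 1 ≤ j ∧ j ≤ n ∧ (1 ≤ p ∨ i < j) then
    FreeAlgebra.ι ℤ (Sum.inr (Sum.inr ⟨(i, j, p), h⟩)) else 0

/-- The double-index generator `c_{αβ}` for integers `α, β`: writing
`α = α₁n + α₂` and `β = β₁n + β₂` with `1 ≤ α₂, β₂ ≤ n`, set
`c_{αβ} = c_{α₂β₂}^{β₁−α₁}` for `α < β` and `c_{αβ} = 0` for `α ≥ β`. -/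
def cInt (n : ℕ) (α β : ℤ) : A18 n :=
  if α < β then
    cGen18 n (((α - 1) % (n : ℤ)).toNat + 1) (((β - 1) % (n : ℤ)).toNat + 1)
      (((β - 1) / (n : ℤ) - (α - 1) / (n : ℤ)).toNat)
  else 0

/-- **Composition formula for the elementary automorphisms `ψ_s` of Gompf
move 6.**  Fix `n ≥ 1`, a sign `η ∈ {1, −1}` and signs `σ : ℤ → {1, −1}` with
`σ(m + n) = σ(m)`.  Let `ψ_s` (`s ≥ n + 1`) be the algebra endomorphism of `A`
with `ψ_s(a_q) = a_q − η σ(s) b_s c_{s, q+n}` for `1 ≤ q ≤ s` and `ψ_s` the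
identity on all other generators.  Then for every `s ≥ n + 1` and `q ≥ 1`,
`(ψ_s ∘ ⋯ ∘ ψ_{n+1})(a_q)
  = a_q − Σ_{m = max(q, n+1)}^{min(s, q+n−1)} η σ(m) b_m c_{m, q+n}`;
in particular the value stabilizes for `s ≥ q + n − 1` at
`a_q − Σ_{m = max(q, n+1)}^{q+n−1} η σ(m) b_m c_{m, q+n}`. -/
theorem stmt_18 (n : ℕ) (hn : 1 ≤ n) (η : ℤ) (hη : η = 1 ∨ η = -1)
    (σ : ℤ → ℤ) (hσval : ∀ m : ℤ, σ m = 1 ∨ σ m = -1)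
    (hσper : ∀ m : ℤ, σ (m + n) = σ m)
    (ψ : ℕ → (A18 n →ₐ[ℤ] A18 n))
    (hψa : ∀ s : ℕ, n + 1 ≤ s → ∀ q : ℕ, 1 ≤ q → q ≤ s →
      ψ s (aGen n q) =
        aGen n q - (η * σ (s : ℤ)) • (bGen n s * cInt n (s : ℤ) ((q : ℤ) + n)))
    (hψa' : ∀ s : ℕ, n + 1 ≤ s → ∀ q : ℕ, s < q → ψ s (aGen n q) = aGen n q)
    (hψb : ∀ s : ℕ, n + 1 ≤ s → ∀ m : ℕ, n + 1 ≤ m → ψ s (bGen n m) = bGen n m)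
    (hψc : ∀ s : ℕ, n + 1 ≤ s → ∀ i j p : ℕ,
      ψ s (cGen18 n i j p) = cGen18 n i j p) :
    ∀ s : ℕ, n + 1 ≤ s → ∀ q : ℕ, 1 ≤ q →
      ((List.range' (n + 1) (s - n)).foldl (fun x m => ψ m x) (aGen n q) =
        aGen n q - ∑ m ∈ Finset.Icc (max q (n + 1)) (min s (q + n - 1)),
          (η * σ (m : ℤ)) • (bGen n m * cInt n (m : ℤ) ((q : ℤ) + n))) ∧
      (q + n - 1 ≤ s →
        (List.range' (n + 1) (s - n)).foldl (fun x m => ψ m x) (aGen n q) =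
          aGen n q - ∑ m ∈ Finset.Icc (max q (n + 1)) (q + n - 1),
            (η * σ (m : ℤ)) • (bGen n m * cInt n (m : ℤ) ((q : ℤ) + n))) := by
  have hc : ∀ s : ℕ, n + 1 ≤ s → ∀ α β : ℤ, ψ s (cInt n α β) = cInt n α β := by
    intro s hs α β
    unfold cInt
    split_ifs
    · exact hψc s hs _ _ _
    · exact map_zero _
  have key : ∀ q : ℕ, 1 ≤ q → ∀ k : ℕ,
      (List.range' (n + 1) k).foldl (fun x m => ψ m x) (aGen n q) =
        aGen n q - ∑ m ∈ Finset.Icc (max q (n + 1)) (min (n + k) (q + n - 1)),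
          (η * σ (m : ℤ)) • (bGen n m * cInt n (m : ℤ) ((q : ℤ) + n)) := by
    intro q hq k
    induction k with
    | zero =>
      rw [Finset.Icc_eq_empty (by omega)]
      simp
    | succ k ih =>
      rw [List.range'_concat, List.foldl_append, ih]
      simp only [List.foldl_cons, List.foldl_nil, one_mul, map_sub, map_sum]
      have hs : n + 1 ≤ n + 1 + k := by omega
      have hsum : ∑ m ∈ Finset.Icc (max q (n + 1)) (min (n + k) (q + n - 1)),
            ψ (n + 1 + k) ((η * σ (m : ℤ)) • (bGen n m * cInt n (m : ℤ) ((q : ℤ) + n))) =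
          ∑ m ∈ Finset.Icc (max q (n + 1)) (min (n + k) (q + n - 1)),
            (η * σ (m : ℤ)) • (bGen n m * cInt n (m : ℤ) ((q : ℤ) + n)) := by
        refine Finset.sum_congr rfl fun m hm => ?_
        rw [Finset.mem_Icc] at hm
        rw [map_zsmul, map_mul, hψb _ hs m (by omega), hc _ hs]
      rw [hsum]
      by_cases h1 : n + 1 + k < q
      · rw [hψa' _ hs q h1, Finset.Icc_eq_empty (by omega), Finset.Icc_eq_empty (by omega)]
      · rw [hψa _ hs q hq (by omega)]
        by_cases h2 : n + 1 + k ≤ q + n - 1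
        · have e1 : min (n + (k + 1)) (q + n - 1) = (n + k) + 1 := by omega
          have e2 : min (n + k) (q + n - 1) = n + k := by omega
          rw [e1, e2, Finset.sum_Icc_succ_top (by omega)]
          have e3 : n + 1 + k = n + k + 1 := by omega
          rw [e3]
          abel
        · have e1 : min (n + (k + 1)) (q + n - 1) = min (n + k) (q + n - 1) := by omega
          have e2 : cInt n ((n + 1 + k : ℕ) : ℤ) ((q : ℤ) + n) = 0 := by
            unfold cInt
            rw [if_neg (by omega)]
          rw [e1, e2, mul_zero, smul_zero, sub_zero]
  intro s hs q hq
  have h := key q hq (s - n)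
  rw [show n + (s - n) = s by omega] at h
  refine ⟨h, fun hqs => ?_⟩
  rw [h, min_eq_right hqs]

end
end
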